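/- arXiv:1605.00049 — 15 statements merged into one kernel-verified Lean document; each statement's English description precedes it below -/
import Mathlib

section
/- For all integers m ≥ 0, n ≥ 0 and r ≥ 0 one has the expansion P_{n+m}^{(r)} = P_m^{(n+r)} · P_n^{(r)} − Σ_{j=1}^{d} ( Σ_{i=1}^{d+1−j} γ_{n+r+1−j}^{d+1−j−i} · P_{m−i}^{(n+r+i)} ) · P_{n−j}^{(r)} in ℂ[x]. -/
open Polynomial

/-- The recurrence of the associated polynomials, extended to all integer indices. -/
theorem dOPS_recurrence_int {d : ℕ} {β : ℕ → ℂ} {γ : ℤ → ℕ → ℂ} {P : ℕ → ℤ → Polynomial ℂ}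
    (hPneg : ∀ (r : ℕ) (n : ℤ), n < 0 → P r n = 0)
    (hP0 : ∀ r : ℕ, P r 0 = 1)
    (hPrec : ∀ r n : ℕ,
      P r ((n : ℤ) + 1) =
        (X - C (β (n + r))) * P r (n : ℤ) -
          ∑ ν ∈ Finset.range d, C (γ ((n : ℤ) + r - ν) (d - 1 - ν)) * P r ((n : ℤ) - 1 - ν))
    (s N : ℕ) (k : ℤ) (hk : k + s = N) :
    P s (k + 1) =
      (X - C (β N)) * P s k -
        ∑ ν ∈ Finset.range d, C (γ ((N : ℤ) - ν) (d - 1 - ν)) * P s (k - 1 - ν) +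
          if k = -1 then 1 else 0 := by
  rcases lt_or_ge k 0 with h | h
  · have hsum : ∑ ν ∈ Finset.range d,
        C (γ ((N : ℤ) - ν) (d - 1 - ν)) * P s (k - 1 - ν) = 0 :=
      Finset.sum_eq_zero fun ν _ => by rw [hPneg s _ (by omega), mul_zero]
    rw [hsum, hPneg s k h]
    split_ifs with h1
    · subst h1
      simp [hP0]
    · rw [hPneg s _ (by omega)]
      simp
  · lift k to ℕ using h
    obtain rfl : k + s = N := by exact_mod_cast hk
    rw [hPrec, if_neg (by omega), add_zero]
    push_cast
    rfl

/-- The connecting coefficients picked out at `i = m + 1` are the terms of the recurrence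
that reach below index `n`. -/
theorem dOPS_boundary_sum (d m : ℕ) (γ : ℤ → ℕ → ℂ) (Q : ℤ → Polynomial ℂ) (n s : ℤ) :
    ∑ j ∈ Finset.Icc 1 d,
        (∑ i ∈ Finset.Icc 1 (d + 1 - j),
          C (γ (s + 1 - j) (d + 1 - j - i)) * if (m : ℤ) - i = -1 then 1 else 0) * Q (n - j) =
      ∑ ν ∈ Finset.range d,
        C (γ (s + m - ν) (d - 1 - ν)) * if m ≤ ν then Q (n + m - 1 - ν) else 0 := by
  have hinner : ∀ j ∈ Finset.Icc 1 d,
      (∑ i ∈ Finset.Icc 1 (d + 1 - j),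
          C (γ (s + 1 - j) (d + 1 - j - i)) * if (m : ℤ) - i = -1 then 1 else 0) * Q (n - j) =
        if m + j ≤ d then C (γ (s + 1 - j) (d - j - m)) * Q (n - j) else 0 := by
    intro j hj
    rw [Finset.mem_Icc] at hj
    have hi : ∀ i : ℕ, (m : ℤ) - i = -1 ↔ m + 1 = i := fun i => by omega
    simp only [hi, mul_ite, mul_one, mul_zero, Finset.sum_ite_eq, Finset.mem_Icc, ite_mul,
      zero_mul]
    rw [show d + 1 - j - (m + 1) = d - j - m by omega]
    exact if_congr (by omega) rfl rfl
  rw [Finset.sum_congr rfl hinner]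
  simp only [mul_ite, mul_zero]
  rw [← Finset.sum_filter, ← Finset.sum_filter]
  refine Finset.sum_bij' (fun j _ => m + j - 1) (fun ν _ => ν + 1 - m) ?_ ?_ ?_ ?_ ?_
  · intro j hj
    simp only [Finset.mem_filter, Finset.mem_Icc, Finset.mem_range] at hj ⊢
    omega
  · intro ν hν
    simp only [Finset.mem_filter, Finset.mem_Icc, Finset.mem_range] at hν ⊢
    omega
  · intro j hj
    simp only [Finset.mem_filter, Finset.mem_Icc] at hj
    omega
  · intro ν hν
    simp only [Finset.mem_filter, Finset.mem_range] at hν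
    omega
  · intro j hj
    simp only [Finset.mem_filter, Finset.mem_Icc] at hj
    rw [show s + m - ((m + j - 1 : ℕ) : ℤ) = s + 1 - j by omega,
      show d - 1 - (m + j - 1) = d - j - m by omega,
      show n + m - 1 - ((m + j - 1 : ℕ) : ℤ) = n - j by omega]

/-- Linear combinations of solutions of an inhomogeneous linear recurrence satisfy the
corresponding combined recurrence. -/
theorem linear_recurrence_combination {R ι κ : Type*} [CommRing R] (S : Finset ι)
    (T : ι → Finset κ) (U : Finset ℕ) (c f₁ f₀ e : ι → κ → R) (f : ι → κ → ℕ → R) (q : ι → R)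
    (a p p₁ p₀ : R) (p' g : ℕ → R)
    (hp : p₁ = a * p₀ - ∑ ν ∈ U, g ν * p' ν)
    (hf : ∀ j ∈ S, ∀ i ∈ T j, f₁ j i = a * f₀ j i - ∑ ν ∈ U, g ν * f j i ν + e j i) :
    p₁ * p - ∑ j ∈ S, (∑ i ∈ T j, c j i * f₁ j i) * q j =
      a * (p₀ * p - ∑ j ∈ S, (∑ i ∈ T j, c j i * f₀ j i) * q j) -
        ∑ ν ∈ U, g ν * (p' ν * p - ∑ j ∈ S, (∑ i ∈ T j, c j i * f j i ν) * q j) -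
          ∑ j ∈ S, (∑ i ∈ T j, c j i * e j i) * q j := by
  have hsum : ∑ j ∈ S, (∑ i ∈ T j, c j i * f₁ j i) * q j =
      a * ∑ j ∈ S, (∑ i ∈ T j, c j i * f₀ j i) * q j -
        ∑ ν ∈ U, g ν * ∑ j ∈ S, (∑ i ∈ T j, c j i * f j i ν) * q j +
          ∑ j ∈ S, (∑ i ∈ T j, c j i * e j i) * q j := by
    simp only [Finset.mul_sum (s := S)]
    rw [Finset.sum_comm (s := U), ← Finset.sum_sub_distrib, ← Finset.sum_add_distrib]
    refine Finset.sum_congr rfl fun j hj => ?_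
    simp only [Finset.sum_mul, Finset.mul_sum]
    rw [Finset.sum_comm (s := U), ← Finset.sum_sub_distrib, ← Finset.sum_add_distrib]
    refine Finset.sum_congr rfl fun i hi => ?_
    have hν : ∑ ν ∈ U, g ν * (c j i * f j i ν * q j) =
        c j i * q j * ∑ ν ∈ U, g ν * f j i ν := by
      rw [Finset.mul_sum]
      exact Finset.sum_congr rfl fun ν _ => by ring
    rw [hf j hj i hi, hν]
    ring
  have hpp : ∑ ν ∈ U, g ν * (p' ν * p) = (∑ ν ∈ U, g ν * p' ν) * p := by
    rw [Finset.sum_mul]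
    exact Finset.sum_congr rfl fun ν _ => by ring
  simp only [mul_sub, Finset.sum_sub_distrib]
  rw [hsum, hp, hpp]
  ring

/-- Expansion of `P_{n+m}^{(r)}` in terms of associated polynomials. -/
theorem dOPS_expansion
    (d : ℕ) (hd : 1 ≤ d)
    (β : ℕ → ℂ) (γ : ℤ → ℕ → ℂ)
    (hγzero : ∀ n : ℤ, n ≤ 0 → ∀ ν : ℕ, γ n ν = 0)
    (hγne : ∀ n : ℤ, 1 ≤ n → γ n 0 ≠ 0)
    (P : ℕ → ℤ → Polynomial ℂ)
    (hPneg : ∀ (r : ℕ) (n : ℤ), n < 0 → P r n = 0)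
    (hP0 : ∀ r : ℕ, P r 0 = 1)
    (hPrec : ∀ r n : ℕ,
      P r ((n : ℤ) + 1) =
        (X - C (β (n + r))) * P r (n : ℤ) -
          ∑ ν ∈ Finset.range d, C (γ ((n : ℤ) + r - ν) (d - 1 - ν)) * P r ((n : ℤ) - 1 - ν))
    (m n r : ℕ) :
    P r ((n : ℤ) + m) =
      P (n + r) (m : ℤ) * P r (n : ℤ) -
        ∑ j ∈ Finset.Icc 1 d,
          (∑ i ∈ Finset.Icc 1 (d + 1 - j),
              C (γ ((n : ℤ) + r + 1 - j) (d + 1 - j - i)) * P (n + r + i) ((m : ℤ) - i)) *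
            P r ((n : ℤ) - j) := by
  induction m using Nat.strong_induction_on with
  | _ m ih =>
  rcases m with _ | m
  · have hsum : ∑ j ∈ Finset.Icc 1 d,
        (∑ i ∈ Finset.Icc 1 (d + 1 - j),
          C (γ ((n : ℤ) + r + 1 - j) (d + 1 - j - i)) * P (n + r + i) (((0 : ℕ) : ℤ) - i)) *
            P r ((n : ℤ) - j) = 0 := by
      refine Finset.sum_eq_zero fun j _ => ?_
      rw [Finset.sum_eq_zero, zero_mul]
      intro i hi
      rw [Finset.mem_Icc] at hi
      rw [hPneg _ _ (by omega), mul_zero]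
    rw [hsum]
    simp [hP0]
  · have hrec := dOPS_recurrence_int hPneg hP0 hPrec
    have hlin := linear_recurrence_combination (Finset.Icc 1 d)
      (fun j => Finset.Icc 1 (d + 1 - j)) (Finset.range d)
      (fun j i => C (γ ((n : ℤ) + r + 1 - j) (d + 1 - j - i)))
      (fun _ i => P (n + r + i) (((m + 1 : ℕ) : ℤ) - i))
      (fun _ i => P (n + r + i) ((m : ℤ) - i))
      (fun _ i => if (m : ℤ) - i = -1 then 1 else 0)
      (fun _ i ν => P (n + r + i) ((m : ℤ) - 1 - ν - i))
      (fun j => P r ((n : ℤ) - j))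
      (X - C (β (n + r + m))) (P r n) (P (n + r) ((m + 1 : ℕ) : ℤ)) (P (n + r) m)
      (fun ν => P (n + r) ((m : ℤ) - 1 - ν))
      (fun ν => C (γ ((n : ℤ) + r + m - ν) (d - 1 - ν)))
      (by
        have h := hrec (n + r) (n + r + m) m (by push_cast; ring)
        rw [if_neg (by omega), add_zero] at h
        exact_mod_cast h)
      (by
        intro j _ i _
        have h := hrec (n + r + i) (n + r + m) ((m : ℤ) - i) (by push_cast; ring)
        rw [show (m : ℤ) - i + 1 = ((m + 1 : ℕ) : ℤ) - i by push_cast; ring] at h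
        rw [h]
        push_cast
        simp only [sub_right_comm _ (i : ℤ)])
    rw [hlin, dOPS_boundary_sum d m γ (P r) n ((n : ℤ) + r), ← ih m (Nat.lt_succ_self m), sub_sub,
      ← Finset.sum_add_distrib]
    have h := hrec r (n + r + m) ((n : ℤ) + m) (by push_cast; ring)
    rw [if_neg (by omega), add_zero] at h
    push_cast at h ⊢
    rw [← add_assoc, h]
    congr 1
    refine Finset.sum_congr rfl fun ν _ => ?_
    rw [← mul_add]
    congr 1
    split_ifs with hν
    · rw [hPneg (n + r) _ (by omega), Finset.sum_eq_zero]
      · ring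
      · intro j _
        rw [Finset.sum_eq_zero, zero_mul]
        intro i _
        rw [hPneg _ _ (by omega), mul_zero]
    · have h' := ih (m - 1 - ν) (by omega)
      rw [show ((m - 1 - ν : ℕ) : ℤ) = (m : ℤ) - 1 - ν by omega] at h'
      rw [add_zero, ← h']
      congr 1
      ring
end

section
/- For all integers n ≥ 0 and r ≥ 0 the following dual recurrence relation holds in ℂ[x]: P_{n+1}^{(r)}(x) = (x − β_r) · P_n^{(r+1)}(x) − Σ_{i=1}^{d} γ_{r+1}^{d−i} · P_{n−i}^{(r+1+i)}(x). -/
open Polynomial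

/-- The defining recurrence extended to all integer degrees: it fails only at degree zero, where
the defect is `1`. -/
lemma associated_recurrence_int (d : ℕ) (β : ℕ → ℂ) (γ : ℤ → ℕ → ℂ) (P : ℕ → ℤ → Polynomial ℂ)
    (hPneg : ∀ (r : ℕ) (n : ℤ), n < 0 → P r n = 0)
    (hP0 : ∀ r : ℕ, P r 0 = 1)
    (hPrec : ∀ r n : ℕ,
      P r ((n : ℤ) + 1) =
        (X - C (β (n + r))) * P r (n : ℤ) -
          ∑ ν ∈ Finset.range d, C (γ ((n : ℤ) + r - ν) (d - 1 - ν)) * P r ((n : ℤ) - 1 - ν))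
    (N s : ℕ) (m : ℤ) (hm : m + s = N + 1) :
    P s m = (X - C (β N)) * P s (m - 1) -
        ∑ ν ∈ Finset.range d, C (γ ((N : ℤ) - ν) (d - 1 - ν)) * P s (m - 2 - ν) +
      if m = 0 then 1 else 0 := by
  rcases lt_or_ge 0 m with h | h
  · obtain ⟨k, rfl⟩ : ∃ k : ℕ, m = k + 1 := ⟨(m - 1).toNat, by omega⟩
    obtain rfl : N = k + s := by omega
    rw [hPrec, if_neg h.ne', add_zero, add_sub_cancel_right]
    congr 1
    refine Finset.sum_congr rfl fun ν _ => ?_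
    congr 2
    ring
  · rw [hPneg s (m - 1) (by omega), Finset.sum_eq_zero fun ν _ => by
      rw [hPneg s (m - 2 - ν) (by omega), mul_zero]]
    rcases h.eq_or_lt with rfl | h
    · simp [hP0]
    · simp [hPneg s m h, h.ne]

/-- Dual recurrence relation for the associated polynomials of a d-OPS. -/
theorem dOPS_dual_recurrence
    (d : ℕ) (hd : 1 ≤ d)
    (β : ℕ → ℂ) (γ : ℤ → ℕ → ℂ)
    (hγzero : ∀ n : ℤ, n ≤ 0 → ∀ ν : ℕ, γ n ν = 0)
    (hγne : ∀ n : ℤ, 1 ≤ n → γ n 0 ≠ 0)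
    (P : ℕ → ℤ → Polynomial ℂ)
    (hPneg : ∀ (r : ℕ) (n : ℤ), n < 0 → P r n = 0)
    (hP0 : ∀ r : ℕ, P r 0 = 1)
    (hPrec : ∀ r n : ℕ,
      P r ((n : ℤ) + 1) =
        (X - C (β (n + r))) * P r (n : ℤ) -
          ∑ ν ∈ Finset.range d, C (γ ((n : ℤ) + r - ν) (d - 1 - ν)) * P r ((n : ℤ) - 1 - ν))
    (n r : ℕ) :
    P r ((n : ℤ) + 1) =
      (X - C (β r)) * P (r + 1) (n : ℤ) -
        ∑ i ∈ Finset.Icc 1 d, C (γ ((r : ℤ) + 1) (d - i)) * P (r + 1 + i) ((n : ℤ) - i) := by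
  have hrec := associated_recurrence_int d β γ P hPneg hP0 hPrec
  have hIcc (f : ℕ → ℂ[X]) : ∑ i ∈ Finset.Icc 1 d, f i = ∑ k ∈ Finset.range d, f (k + 1) := by
    rw [Finset.range_eq_Ico, Finset.sum_Ico_add' f 0 d 1]
    rfl
  induction n using Nat.strong_induction_on with
  | _ n ih =>
  rcases Nat.eq_zero_or_pos n with rfl | hn
  · rw [Finset.sum_eq_zero fun i hi => by
      rw [hPneg _ _ (by have := (Finset.mem_Icc.mp hi).1; omega), mul_zero]]
    rw [hrec r r _ (by push_cast; ring), Finset.sum_eq_zero fun ν _ => by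
      rw [hPneg _ _ (by omega), mul_zero]]
    simp [hP0]
  have hdual (m : ℤ) (hm : m ≤ n) : P r m = (X - C (β r)) * P (r + 1) (m - 1) -
      ∑ i ∈ Finset.Icc 1 d, C (γ ((r : ℤ) + 1) (d - i)) * P (r + 1 + i) (m - 1 - i) +
        if m = 0 then 1 else 0 := by
    rcases lt_or_ge 0 m with h | h
    · obtain ⟨k, rfl⟩ : ∃ k : ℕ, m = k + 1 := ⟨(m - 1).toNat, by omega⟩
      rw [ih k (by omega), if_neg h.ne', add_zero, add_sub_cancel_right]
    · rw [hPneg _ (m - 1) (by omega), Finset.sum_eq_zero fun i _ => by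
        rw [hPneg _ (m - 1 - i) (by omega), mul_zero]]
      rcases h.eq_or_lt with rfl | h
      · simp [hP0]
      · simp [hPneg r m h, h.ne]
  have hdefect : ∑ ν ∈ Finset.range d, C (γ (((n + r : ℕ) : ℤ) - ν) (d - 1 - ν)) *
        (if (n : ℤ) - 1 - ν = 0 then 1 else 0) =
      ∑ i ∈ Finset.Icc 1 d, C (γ ((r : ℤ) + 1) (d - i)) *
        (if (n : ℤ) - i = 0 then 1 else 0) := by
    rw [hIcc]
    refine Finset.sum_congr rfl fun ν _ => ?_
    by_cases h : (n : ℤ) - 1 - ν = 0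
    · rw [if_pos h, if_pos (by push_cast; omega),
        show ((n + r : ℕ) : ℤ) - ν = r + 1 by push_cast; omega, Nat.sub_sub, add_comm 1 ν]
    · rw [if_neg h, if_neg (by push_cast; omega), mul_zero, mul_zero]
  have hleft : ∑ ν ∈ Finset.range d, C (γ (((n + r : ℕ) : ℤ) - ν) (d - 1 - ν)) *
        P r ((n : ℤ) - 1 - ν) =
      (X - C (β r)) * ∑ ν ∈ Finset.range d, C (γ (((n + r : ℕ) : ℤ) - ν) (d - 1 - ν)) *
          P (r + 1) ((n : ℤ) - 2 - ν) -
        ∑ ν ∈ Finset.range d, ∑ i ∈ Finset.Icc 1 d, C (γ (((n + r : ℕ) : ℤ) - ν) (d - 1 - ν)) *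
          (C (γ ((r : ℤ) + 1) (d - i)) * P (r + 1 + i) ((n : ℤ) - i - 2 - ν)) +
        ∑ ν ∈ Finset.range d, C (γ (((n + r : ℕ) : ℤ) - ν) (d - 1 - ν)) *
          (if (n : ℤ) - 1 - ν = 0 then 1 else 0) := by
    rw [Finset.mul_sum, ← Finset.sum_sub_distrib, ← Finset.sum_add_distrib]
    refine Finset.sum_congr rfl fun ν _ => ?_
    rw [hdual _ (by omega), ← Finset.mul_sum,
      show (n : ℤ) - 1 - ν - 1 = n - 2 - ν by ring]
    simp only [show ∀ i : ℕ, (n : ℤ) - 2 - ν - i = n - i - 2 - ν by intro i; ring]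
    ring
  have hright : ∑ i ∈ Finset.Icc 1 d, C (γ ((r : ℤ) + 1) (d - i)) * P (r + 1 + i) ((n : ℤ) - i) =
      (X - C (β (n + r))) * ∑ i ∈ Finset.Icc 1 d, C (γ ((r : ℤ) + 1) (d - i)) *
          P (r + 1 + i) ((n : ℤ) - 1 - i) -
        ∑ i ∈ Finset.Icc 1 d, ∑ ν ∈ Finset.range d, C (γ (((n + r : ℕ) : ℤ) - ν) (d - 1 - ν)) *
          (C (γ ((r : ℤ) + 1) (d - i)) * P (r + 1 + i) ((n : ℤ) - i - 2 - ν)) +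
        ∑ i ∈ Finset.Icc 1 d, C (γ ((r : ℤ) + 1) (d - i)) *
          (if (n : ℤ) - i = 0 then 1 else 0) := by
    rw [Finset.mul_sum, ← Finset.sum_sub_distrib, ← Finset.sum_add_distrib]
    refine Finset.sum_congr rfl fun i _ => ?_
    rw [hrec (n + r) (r + 1 + i) _ (by push_cast; ring),
      show (n : ℤ) - i - 1 = n - 1 - i by ring]
    simp only [mul_left_comm _ (C (γ ((r : ℤ) + 1) (d - i))), ← Finset.mul_sum]
    ring
  rw [hright, hrec (n + r) (r + 1) n (by push_cast; ring),
    if_neg (by omega : ¬(n : ℤ) = 0), hrec (n + r) r (n + 1) (by push_cast; ring),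
    if_neg (by omega : ¬(n : ℤ) + 1 = 0), add_sub_cancel_right,
    show (n : ℤ) + 1 - 2 = n - 1 by ring, hleft, hdual n le_rfl,
    if_neg (by omega : ¬(n : ℤ) = 0), hdefect, Finset.sum_comm]
  ring
end

section
/- For every n ≥ d+1 and r ≥ 0 the determinant B_n^{(r)} satisfies the linear recurrence B_n^{(r)} = − Σ_{k=1}^{d−1} (−1)^{k(d−1)} (Π_{i=1}^{k−1} γ_{r+i}^0) γ_{r+k}^{k} B_{n−k}^{(r+k)} + (−1)^{d(d−1)} (x − β_{r+d−1}) (Π_{i=1}^{d−1} γ_{r+i}^0) B_{n−d}^{(r+d)} + (−1)^{d·d} (Π_{i=1}^{d} γ_{r+i}^0) B_{n−(d+1)}^{(r+d+1)}. -/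
open Polynomial

/-- The rows `v j, …, v (j + e + 1)` with `v (e + 1)` skipped. -/
def skipRow {M : Type*} (e : ℕ) (v : ℕ → M) (j : ℕ) (i : Fin (e + 1)) : M :=
  v (if j + i ≤ e then j + i else j + i + 1)

/-- Moving row `0` of a matrix to position `p` multiplies the determinant by `(-1) ^ p`. -/
lemma det_comp_cycleRange {R : Type*} [CommRing R] {e : ℕ} (p : Fin (e + 1))
    (A : Fin (e + 1) → Fin (e + 1) → R) :
    (Matrix.of A).det = (-1) ^ (p : ℕ) * (Matrix.of fun i => A (p.cycleRange i)).det := by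
  have h := Matrix.det_permute p.cycleRange (Matrix.of A)
  rw [Fin.sign_cycleRange] at h
  have h2 : (Matrix.of fun i => A (p.cycleRange i)).det
      = (-1) ^ (p : ℕ) * (Matrix.of A).det := by
    simpa [Matrix.submatrix] using h
  rw [h2, ← mul_assoc, ← mul_pow]
  simp

lemma det_skipRow_step {R : Type*} [CommRing R] {e : ℕ} (v : ℕ → Fin (e + 1) → R)
    (c : ℕ → R) {j : ℕ} (hj : j ≤ e)
    (hv : v j = ∑ l ∈ Finset.range (e + 2), c l • v (j + 1 + l)) :
    (Matrix.of (skipRow e v j)).det =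
      c (e - j) * ((-1) ^ (e - j) * (Matrix.of fun i : Fin (e + 1) => v (j + 1 + i)).det) +
        c (e + 1) * ((-1) ^ e * (Matrix.of (skipRow e v (j + 1))).det) := by
  set T : (Fin (e + 1) → R) →ₗ[R] R :=
    (Matrix.detRowAlternating (n := Fin (e + 1)) (R := R)).toMultilinearMap.toLinearMap
      (skipRow e v j) 0
  have hTa (w : Fin (e + 1) → R) :
      T w = (Matrix.of (Function.update (skipRow e v j) 0 w)).det := rfl
  have hT0 : T (v j) = (Matrix.of (skipRow e v j)).det := by
    rw [hTa]
    congr 2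
    conv_rhs => rw [← Function.update_eq_self (0 : Fin (e + 1)) (skipRow e v j)]
    simp [skipRow, hj]
  have hTd : T (v (e + 1)) =
      (-1) ^ (e - j) * (Matrix.of fun i : Fin (e + 1) => v (j + 1 + i)).det := by
    rw [hTa, det_comp_cycleRange ⟨e - j, by omega⟩]
    congr 3
    funext i
    rcases lt_trichotomy (i : ℕ) (e - j) with h | h | h
    · have hi : (Fin.cycleRange ⟨e - j, by omega⟩ i : Fin (e + 1)) = ⟨i + 1, by omega⟩ := by
        ext; rw [Fin.coe_cycleRange_of_lt (by simpa [Fin.lt_def] using h)]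
      rw [hi, Function.update_of_ne (by rw [Ne, Fin.ext_iff]; exact Nat.succ_ne_zero _)]
      simp only [skipRow]
      rw [if_pos (by omega)]
      congr 1; omega
    · have hi : (Fin.cycleRange ⟨e - j, by omega⟩ i : Fin (e + 1)) = 0 :=
        Fin.cycleRange_of_eq (by ext; simpa using h)
      rw [hi, Function.update_self]
      congr 1; omega
    · have hi : (Fin.cycleRange ⟨e - j, by omega⟩ i : Fin (e + 1)) = i :=
        Fin.cycleRange_of_gt (by simpa [Fin.lt_def] using h)
      rw [hi, Function.update_of_ne (by rw [Ne, Fin.ext_iff, Fin.val_zero]; omega)]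
      simp only [skipRow]
      rw [if_neg (by omega)]
      congr 1; omega
  have hTl : T (v (j + 1 + (e + 1))) =
      (-1) ^ e * (Matrix.of (skipRow e v (j + 1))).det := by
    rw [hTa, det_comp_cycleRange ⟨e, by omega⟩]
    congr 3
    funext i
    rcases lt_or_eq_of_le (Nat.le_of_lt_succ i.2) with h | h
    · have hi : (Fin.cycleRange ⟨e, by omega⟩ i : Fin (e + 1)) = ⟨i + 1, by omega⟩ := by
        ext; rw [Fin.coe_cycleRange_of_lt (by simpa [Fin.lt_def] using h)]
      rw [hi, Function.update_of_ne (by rw [Ne, Fin.ext_iff]; exact Nat.succ_ne_zero _)]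
      simp only [skipRow, add_assoc, add_comm 1]
    · have hi : (Fin.cycleRange ⟨e, by omega⟩ i : Fin (e + 1)) = 0 :=
        Fin.cycleRange_of_eq (by ext; simpa using h)
      rw [hi, Function.update_self]
      simp only [skipRow]
      rw [if_neg (by omega)]
      congr 1; omega
  have hTz (l : ℕ) (hl : l < e + 1) (hne : l ≠ e - j) : T (v (j + 1 + l)) = 0 := by
    rw [hTa]
    obtain ⟨i, hi0, hi⟩ : ∃ i : Fin (e + 1), 0 ≠ i ∧ skipRow e v j i = v (j + 1 + l) := by
      by_cases h : l < e - j
      · refine ⟨⟨l + 1, by omega⟩, by simp [Fin.ext_iff], ?_⟩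
        simp only [skipRow]
        rw [if_pos (by omega)]
        congr 1; omega
      · refine ⟨⟨l, by omega⟩, by rw [Ne, Fin.ext_iff, Fin.val_zero]; simp only; omega, ?_⟩
        simp only [skipRow]
        rw [if_neg (by omega)]
        congr 1; omega
    refine Matrix.det_zero_of_row_eq hi0 ?_
    funext q
    simp only [Matrix.of_apply]
    rw [Function.update_self, Function.update_of_ne hi0.symm, hi]
  rw [← hT0, ← hTd, ← hTl]
  conv_lhs => rw [hv]
  rw [map_sum, Finset.sum_range_succ]
  simp only [map_smul, smul_eq_mul]
  congr 1
  rw [Finset.sum_eq_single_of_mem (e - j) (by simp)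
    fun l hl hne => by rw [hTz l (by simpa using hl) hne, mul_zero]]
  congr 3; omega

/-- If each `v j` with `j ≤ e` is a combination of the next `e + 2` vectors, then the determinants
of `e + 1` consecutive vectors satisfy the adjoint recurrence. -/
lemma det_consecutive_recurrence {R : Type*} [CommRing R] {e : ℕ}
    (v : ℕ → Fin (e + 1) → R) (c : ℕ → ℕ → R)
    (hv : ∀ j ≤ e, v j = ∑ l ∈ Finset.range (e + 2), c j l • v (j + 1 + l)) :
    (Matrix.of fun i : Fin (e + 1) => v i).det =
      ∑ k ∈ Finset.range (e + 1), (∏ i ∈ Finset.range k, (-1) ^ e * c i (e + 1)) *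
          ((-1) ^ (e - k) * c k (e - k)) * (Matrix.of fun i : Fin (e + 1) => v (k + 1 + i)).det +
        (∏ i ∈ Finset.range (e + 1), (-1) ^ e * c i (e + 1)) *
          (Matrix.of fun i : Fin (e + 1) => v (e + 2 + i)).det := by
  have key : ∀ m ≤ e + 1, (Matrix.of fun i : Fin (e + 1) => v i).det =
      ∑ k ∈ Finset.range m, (∏ i ∈ Finset.range k, (-1) ^ e * c i (e + 1)) *
          ((-1) ^ (e - k) * c k (e - k)) * (Matrix.of fun i : Fin (e + 1) => v (k + 1 + i)).det +
        (∏ i ∈ Finset.range m, (-1) ^ e * c i (e + 1)) * (Matrix.of (skipRow e v m)).det := by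
    intro m hm
    induction m with
    | zero =>
      simp only [Finset.range_zero, Finset.sum_empty, Finset.prod_empty, zero_add, one_mul]
      congr 2
      funext i
      simp only [skipRow, zero_add]
      rw [if_pos (by omega)]
    | succ m ih =>
      rw [ih (by omega), Finset.sum_range_succ, Finset.prod_range_succ,
        det_skipRow_step v (c m) (by omega) (hv m (by omega))]
      ring
  rw [key (e + 1) le_rfl]
  congr 4
  funext i
  simp only [skipRow]
  rw [if_neg (by omega)]
  congr 1; omega

/-- The recurrence linking associated polynomials of different orders. -/
lemma associated_dual_recurrence
    (d : ℕ) (β : ℕ → ℂ) (γ : ℤ → ℕ → ℂ) (P : ℕ → ℤ → Polynomial ℂ)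
    (hPneg : ∀ (r : ℕ) (n : ℤ), n < 0 → P r n = 0)
    (hP0 : ∀ r : ℕ, P r 0 = 1)
    (hPrec : ∀ r n : ℕ,
      P r ((n : ℤ) + 1) =
        (X - C (β (n + r))) * P r (n : ℤ) -
          ∑ ν ∈ Finset.range d, C (γ ((n : ℤ) + r - ν) (d - 1 - ν)) * P r ((n : ℤ) - 1 - ν))
    (r : ℕ) (m : ℤ) :
    P r m = (X - C (β r)) * P (r + 1) (m - 1) -
      ∑ ν ∈ Finset.range d, C (γ ((r : ℤ) + 1) (d - 1 - ν)) * P (r + 2 + ν) (m - 2 - ν) +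
        if m = 0 then 1 else 0 := by
  have fwd (s : ℕ) (k : ℤ) : P s (k + 1) = (X - C (β (k + s).toNat)) * P s k -
      ∑ ν ∈ Finset.range d, C (γ (k + s - ν) (d - 1 - ν)) * P s (k - 1 - ν) +
        if k + 1 = 0 then 1 else 0 := by
    rcases lt_or_ge k 0 with hk | hk
    · rw [hPneg s k hk, Finset.sum_eq_zero fun ν _ => by rw [hPneg s _ (by omega), mul_zero]]
      split_ifs with h
      · simp [h, hP0]
      · simp [hPneg s (k + 1) (by omega)]
    · lift k to ℕ using hk
      rw [hPrec, if_neg (by omega), add_zero]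
      norm_cast
  have small (m : ℤ) (hm : m ≤ 0) :
      P r m = (X - C (β r)) * P (r + 1) (m - 1) -
        ∑ ν ∈ Finset.range d, C (γ ((r : ℤ) + 1) (d - 1 - ν)) * P (r + 2 + ν) (m - 2 - ν) +
          if m = 0 then 1 else 0 := by
    rw [hPneg _ (m - 1) (by omega),
      Finset.sum_eq_zero fun ν _ => by rw [hPneg _ _ (by omega), mul_zero]]
    split_ifs with h
    · simp [h, hP0]
    · simp [hPneg r m (by omega)]
  suffices H : ∀ (N : ℕ) (m : ℤ), m ≤ N →
      P r m = (X - C (β r)) * P (r + 1) (m - 1) -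
        ∑ ν ∈ Finset.range d, C (γ ((r : ℤ) + 1) (d - 1 - ν)) * P (r + 2 + ν) (m - 2 - ν) +
          if m = 0 then 1 else 0 from H m.toNat m (by omega)
  intro N
  induction N with
  | zero => exact fun m hm => small m (by simpa using hm)
  | succ N ih =>
    intro m hm
    rcases lt_or_ge (N : ℤ) m with h | h
    swap
    · exact ih m h
    obtain rfl : m = (N : ℤ) + 1 := by push_cast at hm; omega
    rw [if_neg (by omega), add_zero]
    have e1 : P (r + 1) ((N : ℤ) + 1 - 1) =
        (X - C (β (N + r))) * P (r + 1) ((N : ℤ) - 1) -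
          ∑ ν ∈ Finset.range d, C (γ ((N : ℤ) + r - ν) (d - 1 - ν)) * P (r + 1) ((N : ℤ) - 2 - ν) +
            if (N : ℤ) = 0 then 1 else 0 := by
      have := fwd (r + 1) ((N : ℤ) - 1)
      have h1 : ((N : ℤ) - 1 + (r + 1 : ℕ)) = (N : ℤ) + r := by push_cast; ring
      have h2 : ((N : ℤ) + r).toNat = N + r := by omega
      have h3 : (N : ℤ) - 1 - 1 = N - 2 := by ring
      rw [h1, h2, h3, sub_add_cancel] at this
      rw [add_sub_cancel_right, this]
    have e2 (μ : ℕ) : P (r + 2 + μ) ((N : ℤ) + 1 - 2 - μ) =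
        (X - C (β (N + r))) * P (r + 2 + μ) ((N : ℤ) - 2 - μ) -
          ∑ ν ∈ Finset.range d, C (γ ((N : ℤ) + r - ν) (d - 1 - ν)) *
            P (r + 2 + μ) ((N : ℤ) - 1 - ν - 2 - μ) +
            if (N : ℤ) - 1 - μ = 0 then 1 else 0 := by
      have := fwd (r + 2 + μ) ((N : ℤ) - 2 - μ)
      have h1 : ((N : ℤ) - 2 - μ + (r + 2 + μ : ℕ)) = (N : ℤ) + r := by push_cast; ring
      have h2 : ((N : ℤ) + r).toNat = N + r := by omega
      have h3 : (N : ℤ) - 2 - μ + 1 = N - 1 - μ := by ring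
      have h4 : (N : ℤ) + 1 - 2 - μ = N - 1 - μ := by ring
      have h5 (ν : ℕ) : (N : ℤ) - 2 - μ - 1 - ν = N - 1 - ν - 2 - μ := by ring
      rw [h1, h2, h3] at this
      simp only [h5] at this
      rw [h4, this]
    have e3 (ν : ℕ) := ih ((N : ℤ) - 1 - ν) (by omega)
    have e4 : (X - C (β (N + r))) * (if (N : ℤ) = 0 then 1 else 0 : ℂ[X]) =
        (X - C (β r)) * (if (N : ℤ) = 0 then 1 else 0) := by
      split_ifs with h0
      · have : N = 0 := by exact_mod_cast h0
        simp [this]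
      · simp
    have e5 (ν : ℕ) : C (γ ((N : ℤ) + r - ν) (d - 1 - ν)) *
          (if (N : ℤ) - 1 - ν = 0 then 1 else 0 : ℂ[X]) =
        C (γ ((r : ℤ) + 1) (d - 1 - ν)) * (if (N : ℤ) - 1 - ν = 0 then 1 else 0) := by
      split_ifs with h0
      · rw [show (N : ℤ) + r - ν = r + 1 by omega]
      · simp
    have e6 (ν : ℕ) : (N : ℤ) - 1 - ν - 1 = N - 2 - ν := by ring
    have pull (a : ℂ[X]) (f g : ℕ → ℂ[X]) :
        ∑ ν ∈ Finset.range d, f ν * (a * g ν) = a * ∑ ν ∈ Finset.range d, f ν * g ν := by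
      rw [Finset.mul_sum]
      exact Finset.sum_congr rfl fun ν _ => by ring
    have swap (f g : ℕ → ℂ[X]) (F : ℕ → ℕ → ℂ[X]) :
        ∑ ν ∈ Finset.range d, f ν * ∑ μ ∈ Finset.range d, g μ * F ν μ =
          ∑ μ ∈ Finset.range d, g μ * ∑ ν ∈ Finset.range d, f ν * F ν μ := by
      simp only [Finset.mul_sum]
      rw [Finset.sum_comm]
      exact Finset.sum_congr rfl fun μ _ => Finset.sum_congr rfl fun ν _ => by ring
    rw [hPrec, ih N le_rfl, e1]
    simp only [e2, e3]
    simp only [mul_add, mul_sub, Finset.sum_add_distrib, Finset.sum_sub_distrib, e4, e5, e6]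
    rw [pull (X - C (β r)), pull (X - C (β (N + r))), swap]
    ring

/-- Linear recurrence for the Casorati determinant `B_n^{(r)}`. -/
theorem dOPS_Bdet_recurrence
    (d : ℕ) (hd : 1 ≤ d)
    (β : ℕ → ℂ) (γ : ℤ → ℕ → ℂ)
    (hγzero : ∀ n : ℤ, n ≤ 0 → ∀ ν : ℕ, γ n ν = 0)
    (hγne : ∀ n : ℤ, 1 ≤ n → γ n 0 ≠ 0)
    (P : ℕ → ℤ → Polynomial ℂ)
    (hPneg : ∀ (r : ℕ) (n : ℤ), n < 0 → P r n = 0)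
    (hP0 : ∀ r : ℕ, P r 0 = 1)
    (hPrec : ∀ r n : ℕ,
      P r ((n : ℤ) + 1) =
        (X - C (β (n + r))) * P r (n : ℤ) -
          ∑ ν ∈ Finset.range d, C (γ ((n : ℤ) + r - ν) (d - 1 - ν)) * P r ((n : ℤ) - 1 - ν))
    (B : ℤ → ℕ → Polynomial ℂ)
    (hB : ∀ (n : ℤ) (r : ℕ),
      B n r = Matrix.det (Matrix.of fun i j : Fin d => P (r + (j : ℕ)) (n + (i : ℕ) - (j : ℕ))))
    (n r : ℕ) (hn : d + 1 ≤ n) :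
    B (n : ℤ) r =
      -(∑ k ∈ Finset.Icc 1 (d - 1),
          C ((-1 : ℂ) ^ (k * (d - 1)) * (∏ i ∈ Finset.Icc 1 (k - 1), γ ((r : ℤ) + i) 0) *
              γ ((r : ℤ) + k) k) * B ((n : ℤ) - k) (r + k))
        + C ((-1 : ℂ) ^ (d * (d - 1))) * (X - C (β (r + d - 1))) *
            C (∏ i ∈ Finset.Icc 1 (d - 1), γ ((r : ℤ) + i) 0) * B ((n : ℤ) - d) (r + d)
        + C ((-1 : ℂ) ^ (d * d) * ∏ i ∈ Finset.Icc 1 d, γ ((r : ℤ) + i) 0) *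
            B ((n : ℤ) - (d + 1)) (r + (d + 1)) := by
  obtain ⟨e, rfl⟩ : ∃ e, d = e + 1 := ⟨d - 1, by omega⟩
  have dual := associated_dual_recurrence (e + 1) β γ P hPneg hP0 hPrec
  let v : ℕ → Fin (e + 1) → ℂ[X] := fun k i => P (r + k) ((n : ℤ) + (i : ℕ) - k)
  let c : ℕ → ℕ → ℂ[X] := fun j l =>
    if l = 0 then X - C (β (r + j)) else -C (γ ((r : ℤ) + j + 1) (e + 1 - l))
  have hBv (k : ℕ) : B ((n : ℤ) - k) (r + k) =
      (Matrix.of fun i : Fin (e + 1) => v (k + i)).det := by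
    rw [hB, ← Matrix.det_transpose]
    congr 1
    ext1 i j
    simp only [Matrix.transpose_apply, Matrix.of_apply, v]
    congr 1
    · ring
    · push_cast; ring
  have hv : ∀ j ≤ e, v j = ∑ l ∈ Finset.range (e + 2), c j l • v (j + 1 + l) := by
    intro j hj
    funext i
    rw [Finset.sum_apply, Finset.sum_range_succ']
    simp only [Pi.smul_apply, smul_eq_mul, v, c]
    rw [dual, if_neg (by omega), add_zero, sub_eq_add_neg, add_comm, ← Finset.sum_neg_distrib]
    congr 1
    · refine Finset.sum_congr rfl fun ν _ => ?_
      rw [if_neg (by omega), neg_mul]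
      have h1 : e + 1 - (ν + 1) = e + 1 - 1 - ν := by omega
      have h2 : r + (j + 1 + (ν + 1)) = r + j + 2 + ν := by ring
      have h3 : (n : ℤ) + (i : ℕ) - (j + 1 + (ν + 1) : ℕ) = n + (i : ℕ) - j - 2 - ν := by
        push_cast; ring
      rw [h1, h2, h3, Nat.cast_add]
    · simp only [if_true]
      congr 2
      push_cast; ring
  have hD0 : B (n : ℤ) r = (Matrix.of fun i : Fin (e + 1) => v i).det := by
    simpa using hBv 0
  have hprod (k : ℕ) : ∏ i ∈ Finset.range k, (-1 : ℂ[X]) ^ e * c i (e + 1) =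
      C ((-1) ^ ((e + 1) * k) * ∏ i ∈ Finset.Icc 1 k, γ ((r : ℤ) + i) 0) := by
    induction k with
    | zero => simp
    | succ k ih =>
      rw [Finset.prod_range_succ, ih, Finset.prod_Icc_succ_top (by omega)]
      simp only [c, if_neg (Nat.succ_ne_zero e), Nat.sub_self, C_mul, C_pow, C_neg, C_1]
      push_cast
      rw [← add_assoc]
      ring
  rw [hD0, det_consecutive_recurrence v c hv, Finset.sum_range_succ]
  simp only [← hBv, hprod]
  refine congrArg₂ (· + ·) (congrArg₂ (· + ·) ?_ ?_) ?_
  · rw [← Finset.sum_neg_distrib, Nat.add_sub_cancel, Finset.sum_bij (fun k _ => k + 1)]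
    · intro k hk
      simp only [Finset.mem_range] at hk
      simp only [Finset.mem_Icc]; omega
    · intro a _ b _ h
      omega
    · intro b hb
      simp only [Finset.mem_Icc] at hb
      exact ⟨b - 1, by simp only [Finset.mem_range]; omega, by omega⟩
    · intro k hk
      simp only [Finset.mem_range] at hk
      obtain ⟨t, rfl⟩ : ∃ t, e = k + 1 + t := ⟨e - (k + 1), by omega⟩
      have h1 : k + 1 + t - k = t + 1 := by omega
      have h2 : k + 1 + t + 1 - (t + 1) = k + 1 := by omega
      simp only [c, h1, h2, if_neg (Nat.succ_ne_zero t), Nat.add_sub_cancel]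
      push_cast
      have hs : (-1 : ℂ[X]) ^ ((k + 1 + t + 1) * k) * (-1) ^ (t + 1) =
          (-1) ^ ((k + 1) * (k + 1 + t)) := by
        rw [← pow_add]
        exact neg_one_pow_congr (by simp only [Nat.even_add, Nat.even_mul, Nat.even_add_one]; tauto)
      simp only [C_mul, C_pow, C_neg, C_1]
      rw [← hs, ← add_assoc (r : ℤ)]
      ring
  · simp only [c, Nat.sub_self, if_true, pow_zero, one_mul, Nat.add_sub_cancel, C_mul]
    rw [show r + (e + 1) - 1 = r + e by omega]
    ring
  · rw [show e + 1 + 1 = e + 2 from rfl, ← Nat.cast_add_one]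
end

section
/- For all integers n ≥ 0 and r ≥ 0 one has Δ_n^{(r)} = (−1)^{(d+1)n} · Π_{i=1}^{n} γ_{i+r}^0 (in particular Δ_0^{(r)} = 1 and Δ_n^{(r)} ≠ 0 for all n). -/
open Polynomial

/-- One step of the Casorati determinant of a linear recurrence of order `d + 1`. -/
theorem Matrix.det_casorati_succ {R : Type*} [CommRing R] {d : ℕ}
    (u : ℕ → Fin (d + 1) → R) (c : Fin (d + 1) → R)
    (hu : u (d + 1) = ∑ i, c i • u i) :
    (Matrix.of fun i : Fin (d + 1) => u (i + 1)).det =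
      (-1) ^ d * (c 0 * (Matrix.of fun i : Fin (d + 1) => u i).det) := by
  set M : Matrix (Fin (d + 1)) (Fin (d + 1)) R := Matrix.of fun i => u i with hM
  have hshift : (Matrix.of fun i : Fin (d + 1) => u (i + 1)) =
      (M.updateRow 0 (∑ i, c i • M i)).submatrix (finRotate (d + 1)) id := by
    ext i j
    induction i using Fin.lastCases with
    | last =>
      simp only [Matrix.of_apply, Matrix.submatrix_apply, id, finRotate_last,
        Matrix.updateRow_self, Fin.val_last, hu]
      rfl
    | cast i =>
      have hi : finRotate (d + 1) i.castSucc = i.succ := by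
        simp
      rw [Matrix.submatrix_apply, hi, Matrix.updateRow_ne (Fin.succ_ne_zero i)]
      simp [hM]
  rw [hshift, Matrix.det_permute, Matrix.det_updateRow_sum, sign_finRotate]
  simp

/-- Evaluation of the Casorati determinant `Δ_n^{(r)}`. -/
theorem dOPS_Delta_eval
    (d : ℕ) (hd : 1 ≤ d)
    (β : ℕ → ℂ) (γ : ℤ → ℕ → ℂ)
    (hγzero : ∀ n : ℤ, n ≤ 0 → ∀ ν : ℕ, γ n ν = 0)
    (hγne : ∀ n : ℤ, 1 ≤ n → γ n 0 ≠ 0)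
    (P : ℕ → ℤ → Polynomial ℂ)
    (hPneg : ∀ (r : ℕ) (n : ℤ), n < 0 → P r n = 0)
    (hP0 : ∀ r : ℕ, P r 0 = 1)
    (hPrec : ∀ r n : ℕ,
      P r ((n : ℤ) + 1) =
        (X - C (β (n + r))) * P r (n : ℤ) -
          ∑ ν ∈ Finset.range d, C (γ ((n : ℤ) + r - ν) (d - 1 - ν)) * P r ((n : ℤ) - 1 - ν))
    (Δ : ℤ → ℕ → Polynomial ℂ)
    (hΔ : ∀ (n : ℤ) (r : ℕ),
      Δ n r = Matrix.det
        (Matrix.of fun i j : Fin (d + 1) => P (r + (j : ℕ)) (n + (i : ℕ) - (j : ℕ))))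
    (n r : ℕ) :
    Δ (n : ℤ) r = C ((-1 : ℂ) ^ ((d + 1) * n) * ∏ i ∈ Finset.Icc 1 n, γ ((i : ℤ) + r) 0)
      ∧ Δ 0 r = 1 ∧ Δ (n : ℤ) r ≠ 0 := by
  have hΔ0 : ∀ r, Δ 0 r = 1 := by
    intro r
    rw [hΔ, Matrix.det_of_isLowerTriangular]
    · simp [hP0]
    · intro i j hij
      have hij' : i < j := hij
      exact hPneg _ _ (by rw [Fin.lt_def] at hij'; omega)
  have hstep : ∀ n r : ℕ, Δ ((n + 1 : ℕ) : ℤ) r =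
      (-1) ^ d * (-C (γ (((n + 1 : ℕ) : ℤ) + r) 0) * Δ n r) := by
    intro n r
    obtain ⟨e, rfl⟩ : ∃ e, d = e + 1 := ⟨d - 1, by omega⟩
    let u : ℕ → Fin (e + 1 + 1) → ℂ[X] := fun i j => P (r + (j : ℕ)) (n + (i : ℕ) - (j : ℕ))
    let c : Fin (e + 1 + 1) → ℂ[X] :=
      Fin.snoc (α := fun _ => ℂ[X]) (fun i : Fin (e + 1) => -C (γ ((n : ℤ) + r + i + 1) i))
        (X - C (β (n + (e + 1) + r)))
    have hu : u (e + 1 + 1) = ∑ i, c i • u i := by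
      funext j
      have hj : (j : ℕ) ≤ e + 1 := by omega
      obtain ⟨k, hk⟩ : ∃ k : ℕ, n + (e + 1) = k + (j : ℕ) := ⟨n + (e + 1) - j, by omega⟩
      have hkz : (n : ℤ) + (e + 1) = k + (j : ℕ) := by exact_mod_cast hk
      have hrec := hPrec (r + j) k
      rw [← Finset.sum_range_reflect, Finset.sum_range] at hrec
      rw [Fin.sum_univ_castSucc]
      simp only [c, u, Fin.snoc_castSucc, Fin.snoc_last, Pi.add_apply, Finset.sum_apply,
        Pi.smul_apply, smul_eq_mul, Fin.val_castSucc, Fin.val_last]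
      have hlead : (n : ℤ) + ((e + 1 + 1 : ℕ) : ℤ) - (j : ℕ) = k + 1 := by push_cast; omega
      have hprev : (n : ℤ) + ((e + 1 : ℕ) : ℤ) - (j : ℕ) = k := by push_cast; omega
      rw [hlead, hprev, hrec, show n + (e + 1) + r = k + (r + j) by omega, sub_eq_neg_add,
        ← Finset.sum_neg_distrib]
      congr 1
      refine Finset.sum_congr rfl fun i _ => ?_
      have hi := i.isLt
      rw [neg_mul, show e + 1 - 1 - (e + 1 - 1 - (i : ℕ)) = i by omega,
        show (k : ℤ) + ((r + j : ℕ) : ℤ) - ((e + 1 - 1 - (i : ℕ) : ℕ) : ℤ) = n + r + i + 1 by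
          omega,
        show (k : ℤ) - 1 - ((e + 1 - 1 - (i : ℕ) : ℕ) : ℤ) = n + (i : ℕ) - (j : ℕ) by omega]
    have hc : c 0 = -C (γ (((n + 1 : ℕ) : ℤ) + r) 0) := by
      rw [← Fin.castSucc_zero]
      simp only [c, Fin.snoc_castSucc]
      rw [Fin.val_zero]
      congr 3
      push_cast
      ring
    rw [hΔ, hΔ, ← hc, ← Matrix.det_casorati_succ u c hu]
    congr 1
    ext1 i j
    simp only [Matrix.of_apply, u]
    congr 1
    push_cast
    ring
  have heval : Δ (n : ℤ) r =
      C ((-1 : ℂ) ^ ((d + 1) * n) * ∏ i ∈ Finset.Icc 1 n, γ ((i : ℤ) + r) 0) := by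
    induction n with
    | zero => simp [hΔ0]
    | succ n ih =>
      rw [hstep, ih, Finset.prod_Icc_succ_top (by omega)]
      simp only [map_mul, map_pow, map_neg, map_one]
      ring
  refine ⟨heval, hΔ0 r, ?_⟩
  rw [heval]
  exact C_ne_zero.mpr (mul_ne_zero (pow_ne_zero _ (by norm_num))
    (Finset.prod_ne_zero_iff.mpr fun i hi => hγne _ (by
      have := (Finset.mem_Icc.mp hi).1
      omega)))
end

section
/- Let r ≥ 1, 0 ≤ i ≤ r−1 and n ≥ r−1 be integers. Then the determinant of the (d+1)×(d+1) matrix whose columns are, in order, (P_{n−i+t}^{(i)})_{t=0}^{d} and, for 1 ≤ j ≤ d, (P_{n−r−j+1+t}^{(r+j−1)})_{t=0}^{d}, equals Δ_{n−r+1}^{(r−1)} · P_{r−i−1}^{(i)}(x) = (−1)^{(d+1)(n−r+1)} (Π_{k=r}^{n} γ_k^0) · P_{r−i−1}^{(i)}(x). -/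
open Polynomial

/-- If the rows of `N` are the last `d` rows of `M` followed by the combination `∑ k, a k • M k`
of the rows of `M`, then `det N = (-1) ^ d * a 0 * det M`. -/
theorem Matrix.det_eq_of_shift_rows {R : Type*} [CommRing R] {d : ℕ}
    (M N : Matrix (Fin (d + 1)) (Fin (d + 1)) R) (a : Fin (d + 1) → R)
    (hshift : ∀ t : Fin d, N t.castSucc = M t.succ)
    (hlast : N (Fin.last d) = ∑ k, a k • M k) :
    N.det = (-1) ^ d * a 0 * M.det := by
  have hN : N = (M.submatrix (finRotate (d + 1)) id).updateRow (Fin.last d)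
      (∑ k, a (finRotate (d + 1) k) • M.submatrix (finRotate (d + 1)) id k) := by
    funext t
    refine Fin.lastCases ?_ (fun t => ?_) t
    · rw [Matrix.updateRow_self, hlast]
      exact (Equiv.sum_comp (finRotate (d + 1)) fun k => a k • M k).symm
    · rw [Matrix.updateRow_ne (Fin.castSucc_lt_last t).ne, hshift]
      funext c
      simp [Fin.coeSucc_eq_succ]
  rw [hN, Matrix.det_updateRow_sum, finRotate_last, Matrix.det_permute, sign_finRotate]
  simp only [smul_eq_mul]
  push_cast
  ring

section AssociatedPolynomials

variable {d : ℕ} {β : ℕ → ℂ} {γ : ℤ → ℕ → ℂ} {P : ℕ → ℤ → Polynomial ℂ}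

/-- The recurrence of the associated polynomials, with indices shifted by the order `s` so that
its coefficients do not depend on `s`. -/
theorem associated_recurrence
    (hPrec : ∀ r n : ℕ,
      P r ((n : ℤ) + 1) =
        (X - C (β (n + r))) * P r (n : ℤ) -
          ∑ ν ∈ Finset.range d, C (γ ((n : ℤ) + r - ν) (d - 1 - ν)) * P r ((n : ℤ) - 1 - ν))
    {s n : ℕ} (hs : s ≤ n + d) :
    P s ((n : ℤ) + 1 + d - s) =
      ∑ k : Fin (d + 1),
        (if (k : ℕ) = d then X - C (β (n + d)) else -C (γ ((n : ℤ) + 1 + (k : ℕ)) k)) *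
          P s ((n : ℤ) + (k : ℕ) - s) := by
  obtain ⟨l, hl⟩ := Nat.exists_eq_add_of_le' hs
  have hlz : (n : ℤ) + d = l + s := by exact_mod_cast hl
  rw [Fin.sum_univ_castSucc, Finset.sum_congr rfl (fun k _ => by
      rw [if_neg (show ((Fin.castSucc k : Fin (d + 1)) : ℕ) ≠ d from k.isLt.ne)]),
    show (n : ℤ) + 1 + d - s = l + 1 by linarith, hPrec s l]
  simp only [Fin.val_castSucc, Fin.val_last, if_true]
  rw [Fin.sum_univ_eq_sum_range
      (fun k => -C (γ ((n : ℤ) + 1 + (k : ℕ)) k) * P s ((n : ℤ) + (k : ℕ) - s)) d,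
    ← Finset.sum_range_reflect, hl, show (n : ℤ) + d - s = l by linarith,
    sub_eq_add_neg _ (Finset.sum _ _), ← Finset.sum_neg_distrib, add_comm]
  refine congrArg (· + _) (Finset.sum_congr rfl fun ν hν => ?_)
  have hν' : ((d - 1 - ν : ℕ) : ℤ) = d - 1 - ν := by
    have := Finset.mem_range.mp hν
    omega
  have hsub : d - 1 - (d - 1 - ν) = ν := by
    have := Finset.mem_range.mp hν
    omega
  rw [neg_mul, hν', hsub, show (n : ℤ) + 1 + ν = l + s - (d - 1 - ν) by linarith,
    show (n : ℤ) + ν - s = l - 1 - (d - 1 - ν) by linarith]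

/-- The Casorati matrix at `n` of the associated polynomials of orders
`i, r, r + 1, …, r + d - 1`. -/
noncomputable def casoratiMatrix (d : ℕ) (P : ℕ → ℤ → Polynomial ℂ) (r i : ℕ) (n : ℤ) :
    Matrix (Fin (d + 1)) (Fin (d + 1)) (Polynomial ℂ) :=
  Matrix.of fun t c =>
    P (if (c : ℕ) = 0 then i else r + c - 1)
      (n + (t : ℕ) - (if (c : ℕ) = 0 then i else r + c - 1 : ℕ))

theorem det_casoratiMatrix_succ (hd : 1 ≤ d)
    (hPrec : ∀ r n : ℕ,
      P r ((n : ℤ) + 1) =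
        (X - C (β (n + r))) * P r (n : ℤ) -
          ∑ ν ∈ Finset.range d, C (γ ((n : ℤ) + r - ν) (d - 1 - ν)) * P r ((n : ℤ) - 1 - ν))
    {r i n : ℕ} (hi : i ≤ r - 1) (hn : r - 1 ≤ n) :
    (casoratiMatrix d P r i (n + 1)).det =
      C ((-1) ^ (d + 1) * γ ((n : ℤ) + 1) 0) * (casoratiMatrix d P r i n).det := by
  rw [Matrix.det_eq_of_shift_rows (casoratiMatrix d P r i n) (casoratiMatrix d P r i (n + 1))
    (fun k => if (k : ℕ) = d then X - C (β (n + d)) else -C (γ ((n : ℤ) + 1 + (k : ℕ)) k))]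
  · rw [if_neg (by simp; omega)]
    simp only [Fin.val_zero, Nat.cast_zero, add_zero, map_mul, map_pow, map_neg, map_one]
    ring
  · intro t
    funext c
    simp only [casoratiMatrix, Matrix.of_apply, Fin.val_castSucc, Fin.val_succ]
    congr 1
    push_cast
    ring
  · funext c
    simp only [casoratiMatrix, Matrix.of_apply, Finset.sum_apply, Pi.smul_apply, smul_eq_mul,
      Fin.val_last]
    refine associated_recurrence hPrec ?_
    have := c.isLt
    split_ifs <;> omega

theorem det_casoratiMatrix_base
    (hPneg : ∀ (r : ℕ) (n : ℤ), n < 0 → P r n = 0)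
    (hP0 : ∀ r : ℕ, P r 0 = 1) (r i : ℕ) :
    (casoratiMatrix d P (r + 1) i r).det = P i ((r : ℤ) - i) := by
  rw [Matrix.det_of_isLowerTriangular, Fin.prod_univ_succ, Finset.prod_eq_one, mul_one]
  · simp [casoratiMatrix]
  · intro c _
    simp only [casoratiMatrix, Matrix.of_apply, Fin.val_succ, Nat.add_eq_zero_iff, one_ne_zero,
      and_false, if_false]
    rw [← hP0 (r + 1 + ((c : ℕ) + 1) - 1)]
    congr 1
    omega
  · intro t c htc
    have htc' : (t : ℕ) < c := htc
    simp only [casoratiMatrix, Matrix.of_apply]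
    rw [if_neg (by omega)]
    exact hPneg _ _ (by omega)

theorem det_casoratiMatrix (hd : 1 ≤ d)
    (hPneg : ∀ (r : ℕ) (n : ℤ), n < 0 → P r n = 0)
    (hP0 : ∀ r : ℕ, P r 0 = 1)
    (hPrec : ∀ r n : ℕ,
      P r ((n : ℤ) + 1) =
        (X - C (β (n + r))) * P r (n : ℤ) -
          ∑ ν ∈ Finset.range d, C (γ ((n : ℤ) + r - ν) (d - 1 - ν)) * P r ((n : ℤ) - 1 - ν))
    {r i n : ℕ} (hi : i ≤ r) (hn : r ≤ n) :
    (casoratiMatrix d P (r + 1) i n).det =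
      C ((-1 : ℂ) ^ ((d + 1) * (n - r)) * ∏ k ∈ Finset.Icc (r + 1) n, γ (k : ℤ) 0) *
        P i ((r : ℤ) - i) := by
  induction n, hn using Nat.le_induction with
  | base => simp [det_casoratiMatrix_base hPneg hP0]
  | succ n hn ih =>
    rw [Nat.cast_succ, det_casoratiMatrix_succ hd hPrec hi hn, ih, ← mul_assoc, ← C_mul,
      Finset.prod_Icc_succ_top (by omega), Nat.succ_sub hn, Nat.mul_succ, pow_add]
    push_cast
    congr 2
    ring

end AssociatedPolynomials

/-- Evaluation of the Casorati determinant `D_{n-i}^{(i)}`. -/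
theorem dOPS_Ddet_eval
    (d : ℕ) (hd : 1 ≤ d)
    (β : ℕ → ℂ) (γ : ℤ → ℕ → ℂ)
    (hγzero : ∀ n : ℤ, n ≤ 0 → ∀ ν : ℕ, γ n ν = 0)
    (hγne : ∀ n : ℤ, 1 ≤ n → γ n 0 ≠ 0)
    (P : ℕ → ℤ → Polynomial ℂ)
    (hPneg : ∀ (r : ℕ) (n : ℤ), n < 0 → P r n = 0)
    (hP0 : ∀ r : ℕ, P r 0 = 1)
    (hPrec : ∀ r n : ℕ,
      P r ((n : ℤ) + 1) =
        (X - C (β (n + r))) * P r (n : ℤ) -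
          ∑ ν ∈ Finset.range d, C (γ ((n : ℤ) + r - ν) (d - 1 - ν)) * P r ((n : ℤ) - 1 - ν))
    (Δ : ℤ → ℕ → Polynomial ℂ)
    (hΔ : ∀ (n : ℤ) (r : ℕ),
      Δ n r = Matrix.det
        (Matrix.of fun i j : Fin (d + 1) => P (r + (j : ℕ)) (n + (i : ℕ) - (j : ℕ))))
    (r i n : ℕ) (hr : 1 ≤ r) (hi : i ≤ r - 1) (hn : r - 1 ≤ n) :
    Matrix.det (Matrix.of fun t c : Fin (d + 1) =>
        if (c : ℕ) = 0 then P i ((n : ℤ) - i + (t : ℕ))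
        else P (r + (c : ℕ) - 1) ((n : ℤ) - r - (c : ℕ) + 1 + (t : ℕ)))
      = Δ ((n : ℤ) - r + 1) (r - 1) * P i ((r : ℤ) - i - 1)
    ∧ Matrix.det (Matrix.of fun t c : Fin (d + 1) =>
        if (c : ℕ) = 0 then P i ((n : ℤ) - i + (t : ℕ))
        else P (r + (c : ℕ) - 1) ((n : ℤ) - r - (c : ℕ) + 1 + (t : ℕ)))
      = C ((-1 : ℂ) ^ ((d + 1) * (n + 1 - r)) * ∏ k ∈ Finset.Icc r n, γ (k : ℤ) 0) *
          P i ((r : ℤ) - i - 1) := by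
  obtain ⟨r, rfl⟩ := Nat.exists_eq_add_of_le' hr
  simp only [Nat.add_sub_cancel] at hi hn
  have hmatrix : (Matrix.of fun t c : Fin (d + 1) =>
        if (c : ℕ) = 0 then P i ((n : ℤ) - i + (t : ℕ))
        else P (r + 1 + (c : ℕ) - 1) ((n : ℤ) - (r + 1 : ℕ) - (c : ℕ) + 1 + (t : ℕ)))
      = casoratiMatrix d P (r + 1) i n := by
    ext1 t c
    simp only [casoratiMatrix, Matrix.of_apply]
    split_ifs <;> congr 1 <;> omega
  have hΔ' : Δ ((n : ℤ) - (r + 1 : ℕ) + 1) (r + 1 - 1) = (casoratiMatrix d P (r + 1) r n).det := by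
    rw [hΔ]
    congr 1
    ext1 t c
    simp only [casoratiMatrix, Matrix.of_apply]
    have hc : (if (c : ℕ) = 0 then r else r + 1 + (c : ℕ) - 1) = r + c := by
      split_ifs <;> omega
    rw [hc, Nat.add_sub_cancel]
    congr 1
    omega
  rw [hmatrix, hΔ', det_casoratiMatrix hd hPneg hP0 hPrec hi hn,
    det_casoratiMatrix hd hPneg hP0 hPrec le_rfl hn, sub_self, hP0, mul_one,
    show ((r + 1 : ℕ) : ℤ) - i - 1 = r - i by push_cast; ring, Nat.add_sub_add_right]
  exact ⟨rfl, rfl⟩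
end

section
/- For any integers m_1, …, m_d > n ≥ 0 and any r ≥ 0, one has F^{(r)}(n; m_1, …, m_d) = Δ_n^{(r)} · det M, where M is the d×d matrix whose (i,j) entry, for 1 ≤ i ≤ d and 0 ≤ j ≤ d−1, is P_{m_i−n−1−j}^{(r+n+1+j)}. -/
open Polynomial

/-- Values of a solution of a linear recurrence of order `d + 1` are universal linear combinations
of `d + 1` consecutive values. -/
theorem exists_coeff_of_linearRecurrence {R : Type*} [CommRing R] (n d : ℕ) (a : ℕ → ℕ → R)
    (m : ℕ) (hm : n ≤ m) :
    ∃ c : Fin (d + 1) → R, ∀ y : ℕ → R,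
      (∀ k, n + d ≤ k → y (k + 1) = ∑ ν ∈ Finset.range (d + 1), a k ν * y (k - ν)) →
        y m = ∑ i, c i * y (n + (i : ℕ)) := by
  induction m using Nat.strong_induction_on with
  | _ m ih =>
    by_cases h : m ≤ n + d
    · refine ⟨Pi.single ⟨m - n, by omega⟩ 1, fun y _ => ?_⟩
      simp [Pi.single_apply, Nat.add_sub_cancel' hm]
    · obtain ⟨k, rfl⟩ : ∃ k, m = k + 1 := ⟨m - 1, by omega⟩
      have ih' : ∀ ν : Fin (d + 1), ∃ c : Fin (d + 1) → R, ∀ y : ℕ → R,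
          (∀ k, n + d ≤ k → y (k + 1) = ∑ ν ∈ Finset.range (d + 1), a k ν * y (k - ν)) →
            y (k - ν) = ∑ i, c i * y (n + (i : ℕ)) :=
        fun ν => ih (k - ν) (by omega) (by omega)
      choose c hc using ih'
      refine ⟨fun i => ∑ ν : Fin (d + 1), a k ν * c ν i, fun y hy => ?_⟩
      rw [hy k (by omega), Finset.sum_range]
      simp only [Finset.sum_mul]
      rw [Finset.sum_comm]
      refine Finset.sum_congr rfl fun ν _ => ?_
      rw [hc ν y hy, Finset.mul_sum]
      simp only [mul_assoc]

/-- Expansion of a determinant whose first row is `(1, 0, …, 0)`. -/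
theorem Matrix.det_eq_det_submatrix_of_row_zero {R : Type*} [CommRing R] {d : ℕ}
    (A : Matrix (Fin (d + 1)) (Fin (d + 1)) R) (hA : A 0 = Pi.single 0 1) :
    A.det = (A.submatrix Fin.succ Fin.succ).det := by
  rw [Matrix.det_succ_row_zero, Fin.sum_univ_succ]
  simp [hA]

/-- Factorization of the Casorati determinant `F_n^{(r)}`. -/
theorem dOPS_Fdet_eval
    (d : ℕ) (hd : 1 ≤ d)
    (β : ℕ → ℂ) (γ : ℤ → ℕ → ℂ)
    (hγzero : ∀ n : ℤ, n ≤ 0 → ∀ ν : ℕ, γ n ν = 0)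
    (hγne : ∀ n : ℤ, 1 ≤ n → γ n 0 ≠ 0)
    (P : ℕ → ℤ → Polynomial ℂ)
    (hPneg : ∀ (r : ℕ) (n : ℤ), n < 0 → P r n = 0)
    (hP0 : ∀ r : ℕ, P r 0 = 1)
    (hPrec : ∀ r n : ℕ,
      P r ((n : ℤ) + 1) =
        (X - C (β (n + r))) * P r (n : ℤ) -
          ∑ ν ∈ Finset.range d, C (γ ((n : ℤ) + r - ν) (d - 1 - ν)) * P r ((n : ℤ) - 1 - ν))
    (Δ : ℤ → ℕ → Polynomial ℂ)
    (hΔ : ∀ (n : ℤ) (r : ℕ),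
      Δ n r = Matrix.det
        (Matrix.of fun i j : Fin (d + 1) => P (r + (j : ℕ)) (n + (i : ℕ) - (j : ℕ))))
    (n r : ℕ) (m : Fin d → ℕ) (hm : ∀ t, n < m t) :
    Matrix.det (Matrix.of fun i j : Fin (d + 1) =>
        P (r + (j : ℕ)) (Matrix.vecCons ((n : ℤ)) (fun t => (m t : ℤ)) i - (j : ℕ)))
      = Δ (n : ℤ) r *
          Matrix.det (Matrix.of fun (i : Fin d) (j : Fin d) =>
            P (r + n + 1 + (j : ℕ)) ((m i : ℤ) - n - 1 - (j : ℕ))) := by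
  let a : ℕ → ℕ → Polynomial ℂ := fun k ν =>
    Nat.casesOn ν (X - C (β (k + r))) fun ν => -C (γ ((k : ℤ) + r - ν) (d - 1 - ν))
  have hrec : ∀ s k : ℕ, n + d ≤ k → s ≤ k → P (r + s) (((k + 1 : ℕ) : ℤ) - s) =
      ∑ ν ∈ Finset.range (d + 1), a k ν * P (r + s) (((k - ν : ℕ) : ℤ) - s) := by
    intro s k hk hs
    obtain ⟨l, rfl⟩ := Nat.exists_eq_add_of_le' hs
    have h := hPrec (r + s) l
    rw [show (((l + s + 1 : ℕ) : ℤ) - s) = (l : ℤ) + 1 by push_cast; ring, h,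
      Finset.sum_range_succ', sub_eq_neg_add, ← Finset.sum_neg_distrib]
    congr 1
    · refine Finset.sum_congr rfl fun ν hν => ?_
      simp only [a]
      rw [neg_mul, show ((l : ℤ) + ((r + s : ℕ) : ℤ) - ν) = ((l + s : ℕ) : ℤ) + r - ν by
          push_cast; ring,
        show (((l + s - (ν + 1) : ℕ) : ℤ) - s) = (l : ℤ) - 1 - ν by
          have := Finset.mem_range.mp hν
          omega]
    · rw [show l + (r + s) = l + s + r by ring,
        show (((l + s - 0 : ℕ) : ℤ) - s) = l by simp]
      rfl
  choose c hc using fun t => exists_coeff_of_linearRecurrence n d a (m t) (hm t).le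
  let A : Matrix (Fin (d + 1)) (Fin (d + 1)) (Polynomial ℂ) :=
    Matrix.of (Matrix.vecCons (Pi.single 0 1) c)
  let U : Matrix (Fin d) (Fin d) (Polynomial ℂ) :=
    Matrix.of fun i j => P (r + n + 1 + (j : ℕ)) ((i : ℤ) - (j : ℤ))
  have hU : U.det = 1 := by
    rw [Matrix.det_of_isLowerTriangular]
    · simp [U, hP0]
    · intro i j hij
      have hij : (i : ℕ) < j := hij
      exact hPneg _ _ (by omega)
  have hF : (Matrix.of fun i j : Fin (d + 1) =>
      P (r + (j : ℕ)) (Matrix.vecCons ((n : ℤ)) (fun t => (m t : ℤ)) i - (j : ℕ))) =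
      A * Matrix.of fun i j : Fin (d + 1) => P (r + (j : ℕ)) ((n : ℤ) + (i : ℕ) - (j : ℕ)) := by
    ext1 i j
    refine Fin.cases ?_ (fun t => ?_) i
    · simp [A, Matrix.mul_apply, Pi.single_apply]
    · simpa [A, Matrix.mul_apply] using
        hc t (fun k => P (r + (j : ℕ)) ((k : ℤ) - (j : ℕ))) fun k hk => hrec j k hk (by omega)
  have hM : (Matrix.of fun (i : Fin d) (j : Fin d) =>
      P (r + n + 1 + (j : ℕ)) ((m i : ℤ) - n - 1 - (j : ℕ))) =
      A.submatrix Fin.succ Fin.succ * U := by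
    ext1 i j
    have h := hc i (fun k => P (r + (n + 1 + j)) ((k : ℤ) - ((n + 1 + j : ℕ) : ℤ)))
      fun k hk => hrec _ k hk (by omega)
    rw [Fin.sum_univ_succ] at h
    rw [hPneg _ (((n + ((0 : Fin (d + 1)) : ℕ) : ℕ) : ℤ) - ((n + 1 + j : ℕ) : ℤ))
      (by simp only [Fin.val_zero]; omega), mul_zero, zero_add] at h
    simp only [Matrix.mul_apply, Matrix.of_apply, Matrix.submatrix_apply, A, U,
      Matrix.cons_val_succ]
    convert h using 2
    · ring
    · push_cast; ring
    · refine congrArg _ (congrArg₂ P (by ring) ?_)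
      push_cast [Fin.val_succ]
      ring
  rw [hF, hM, hΔ, Matrix.det_mul, Matrix.det_mul, hU, mul_one, mul_comm,
    Matrix.det_eq_det_submatrix_of_row_zero A rfl]
end

section
/- For n ≥ 0 and r ≥ 0 let ∇_n^{(r)} denote the determinant of the (d+1)×(d+1) matrix whose first column is (Q_{n+t})_{t=0}^{d} and whose j-th further column, for 1 ≤ j ≤ d, is (P_{n−r−j+1+t}^{(r+j−1)})_{t=0}^{d}. Then ∇_n^{(0)} = (−1)^{d+1} A_d · Δ_n^{(0)} for all n ≥ 0, and for every r ≥ 1 and every n ≥ r−1, ∇_n^{(r)} = Q_{r−1} · Δ_{n−r+1}^{(r−1)} = (P_{r−1} − Σ_{i=1}^{d} A_i P_{r−1−i}^{(i)}) · Δ_{n−r+1}^{(r−1)}. -/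
open Polynomial

/-- Any sequence agrees, up to index `N`, with a combination of the first `N + 1` members of a
unitriangular family, the leading coefficient being the first term of the sequence. -/
theorem exists_coeff_of_unitriangular {R : Type*} [CommRing R] (F : ℕ → ℕ → R)
    (hF0 : ∀ j m, m < j → F j m = 0) (hF1 : ∀ j, F j j = 1) (f : ℕ → R) (N : ℕ) :
    ∃ B : ℕ → R, B 0 = f 0 ∧ ∀ m ≤ N, f m = ∑ j ∈ Finset.range (N + 1), B j * F j m := by
  induction N with
  | zero =>
    refine ⟨fun _ => f 0, rfl, fun m hm => ?_⟩
    obtain rfl : m = 0 := by omega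
    simp [hF1]
  | succ N ih =>
    obtain ⟨B, hB0, hB⟩ := ih
    set b := f (N + 1) - ∑ j ∈ Finset.range (N + 1), B j * F j (N + 1) with hb
    have hupd : ∀ m, ∑ j ∈ Finset.range (N + 1), Function.update B (N + 1) b j * F j m =
        ∑ j ∈ Finset.range (N + 1), B j * F j m := fun m =>
      Finset.sum_congr rfl fun j hj => by
        rw [Function.update_of_ne (Finset.mem_range.1 hj).ne]
    refine ⟨Function.update B (N + 1) b, ?_, fun m hm => ?_⟩
    · rw [Function.update_of_ne (by omega), hB0]
    · rw [Finset.sum_range_succ, hupd, Function.update_self]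
      rcases hm.lt_or_eq with h | rfl
      · rw [hF0 _ _ h, mul_zero, add_zero, hB m (by omega)]
      · rw [hF1, hb]
        ring

/-- Two solutions of a linear recurrence of order `d + 1` with the same initial values agree. -/
theorem eq_of_linear_recurrence {R : Type*} [CommRing R] {d : ℕ} (a : ℕ → R) (b : ℕ → ℕ → R)
    {f g : ℕ → R}
    (hf : ∀ m, d ≤ m → f (m + 1) = a m * f m - ∑ ν ∈ Finset.range d, b m ν * f (m - 1 - ν))
    (hg : ∀ m, d ≤ m → g (m + 1) = a m * g m - ∑ ν ∈ Finset.range d, b m ν * g (m - 1 - ν))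
    (h : ∀ m ≤ d, f m = g m) (m : ℕ) : f m = g m := by
  induction m using Nat.strong_induction_on with
  | _ m ih =>
    by_cases hm : m ≤ d
    · exact h m hm
    · obtain ⟨k, rfl⟩ : ∃ k, m = k + 1 := ⟨m - 1, by omega⟩
      rw [hf k (by omega), hg k (by omega), ih k (by omega)]
      congr 1
      exact Finset.sum_congr rfl fun ν _ => by rw [ih (k - 1 - ν) (by omega)]

/-- A combination of solutions of a linear recurrence is a solution. -/
theorem linear_recurrence_sum {R : Type*} [CommRing R] {d m : ℕ} (s : Finset ℕ) (a : R) (b : ℕ → R)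
    (B : ℕ → R) (F : ℕ → ℕ → R)
    (hF : ∀ j ∈ s, F j (m + 1) = a * F j m - ∑ ν ∈ Finset.range d, b ν * F j (m - 1 - ν)) :
    ∑ j ∈ s, B j * F j (m + 1) =
      a * ∑ j ∈ s, B j * F j m -
        ∑ ν ∈ Finset.range d, b ν * ∑ j ∈ s, B j * F j (m - 1 - ν) := by
  rw [Finset.sum_congr rfl fun j hj => by rw [hF j hj]]
  simp only [mul_sub, Finset.sum_sub_distrib, Finset.mul_sum]
  rw [Finset.sum_comm (s := s)]
  congr 1
  · exact Finset.sum_congr rfl fun j _ => by ring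
  · exact Finset.sum_congr rfl fun ν _ => Finset.sum_congr rfl fun j _ => by ring

/-- Replacing the column `k` by a combination `c` of all columns multiplies the determinant by `c k`. -/
theorem det_eq_of_col_eq_sum {R : Type*} [CommRing R] {d : ℕ}
    (M D : Matrix (Fin (d + 1)) (Fin (d + 1)) R) (k : Fin (d + 1)) (c : Fin (d + 1) → R)
    (hk : ∀ t, M t k = ∑ j, c j * D t j) (hM : ∀ t j, j ≠ k → M t j = D t j) :
    M.det = c k * D.det := by
  have : M = D.updateCol k (fun t => ∑ j, c j • D t j) := by
    ext t j
    rw [Matrix.updateCol_apply]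
    split_ifs with h
    · rw [h, hk]
      rfl
    · exact hM t j h
  rw [this, Matrix.det_updateCol_sum, smul_eq_mul]

/-- Evaluation of the Casorati determinant `∇_n^{(r)}` with co-polynomial entries. -/
theorem dOPS_nabla_eval
    (d : ℕ) (hd : 1 ≤ d)
    (β : ℕ → ℂ) (γ : ℤ → ℕ → ℂ)
    (hγzero : ∀ n : ℤ, n ≤ 0 → ∀ ν : ℕ, γ n ν = 0)
    (hγne : ∀ n : ℤ, 1 ≤ n → γ n 0 ≠ 0)
    (P : ℕ → ℤ → Polynomial ℂ)
    (hPneg : ∀ (r : ℕ) (n : ℤ), n < 0 → P r n = 0)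
    (hP0 : ∀ r : ℕ, P r 0 = 1)
    (hPrec : ∀ r n : ℕ,
      P r ((n : ℤ) + 1) =
        (X - C (β (n + r))) * P r (n : ℤ) -
          ∑ ν ∈ Finset.range d, C (γ ((n : ℤ) + r - ν) (d - 1 - ν)) * P r ((n : ℤ) - 1 - ν))
    (Δ : ℤ → ℕ → Polynomial ℂ)
    (hΔ : ∀ (n : ℤ) (r : ℕ),
      Δ n r = Matrix.det
        (Matrix.of fun i j : Fin (d + 1) => P (r + (j : ℕ)) (n + (i : ℕ) - (j : ℕ))))
    (Q : ℕ → Polynomial ℂ) (hQ0 : Q 0 = 1)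
    (hQrec : ∀ m : ℕ,
      Q (m + d + 1) =
        (X - C (β (m + d))) * Q (m + d) -
          ∑ ν ∈ Finset.range d, C (γ ((m : ℤ) + d - ν) (d - 1 - ν)) * Q (m + d - 1 - ν))
    (A : ℕ → Polynomial ℂ)
    (hA : ∀ n : ℕ, Q n = P 0 (n : ℤ) - ∑ i ∈ Finset.Icc 1 d, A i * P i ((n : ℤ) - i))
    (Nab : ℕ → ℕ → Polynomial ℂ)
    (hNab : ∀ n r : ℕ,
      Nab n r = Matrix.det (Matrix.of fun t c : Fin (d + 1) =>
        if (c : ℕ) = 0 then Q (n + (t : ℕ))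
        else P (r + (c : ℕ) - 1) ((n : ℤ) - r - (c : ℕ) + 1 + (t : ℕ)))) :
    (∀ n : ℕ, Nab n 0 = (-1 : Polynomial ℂ) ^ (d + 1) * A d * Δ (n : ℤ) 0)
    ∧ (∀ r : ℕ, 1 ≤ r → ∀ n : ℕ, r - 1 ≤ n →
        Nab n r = Q (r - 1) * Δ ((n : ℤ) + 1 - r) (r - 1)
        ∧ Nab n r =
            (P 0 ((r : ℤ) - 1) - ∑ i ∈ Finset.Icc 1 d, A i * P i ((r : ℤ) - 1 - i)) *
              Δ ((n : ℤ) + 1 - r) (r - 1)) := by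
  constructor
  · intro n
    rw [hNab, hΔ]
    set M : Matrix (Fin (d + 1)) (Fin (d + 1)) ℂ[X] := Matrix.of fun t c =>
      if (c : ℕ) = 0 then Q (n + (t : ℕ))
      else P (0 + (c : ℕ) - 1) ((n : ℤ) - (0 : ℕ) - (c : ℕ) + 1 + (t : ℕ)) with hMdef
    have hrot := Matrix.det_permute' (finRotate (d + 1)) M
    rw [sign_finRotate, det_eq_of_col_eq_sum _
      (Matrix.of fun i j : Fin (d + 1) => P (0 + (j : ℕ)) ((n : ℤ) + (i : ℕ) - (j : ℕ)))
      (Fin.last d) (fun j => if (j : ℕ) = 0 then 1 else -A j)] at hrot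
    · rw [Fin.val_last, if_neg (by omega)] at hrot
      have hsq : ((-1 : ℂ[X]) ^ d) * (-1) ^ d = 1 := by
        rw [← mul_pow]
        simp
      push_cast at hrot
      linear_combination (-(-1 : ℂ[X]) ^ d) * hrot - M.det * hsq
    · intro t
      simp only [hMdef, Matrix.submatrix_apply, id, finRotate_last, Matrix.of_apply, Fin.val_zero,
        if_true]
      rw [Fin.sum_univ_eq_sum_range
        (fun j => (if j = 0 then 1 else -A j) * P (0 + j) ((n : ℤ) + (t : ℕ) - (j : ℕ))),
        Finset.sum_range_succ', hA, Finset.range_eq_Ico, Finset.sum_Ico_add'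
          (fun j => (if j = 0 then 1 else -A j) * P (0 + j) ((n : ℤ) + (t : ℕ) - (j : ℕ))) 0 d 1,
        sub_eq_neg_add, ← Finset.sum_neg_distrib]
      congr 1
      · refine Finset.sum_congr (by ext; simp) fun i hi => ?_
        rw [if_neg (by have := Finset.mem_Ico.1 hi; omega)]
        simp
      · simp
    · intro t j hj
      have hlt : (j : ℕ) < d := Fin.val_lt_last hj
      have hval : ((finRotate (d + 1) j : Fin (d + 1)) : ℕ) = j + 1 :=
        coe_finRotate_of_ne_last hj
      simp only [hMdef, Matrix.submatrix_apply, id, Matrix.of_apply, hval]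
      rw [if_neg (by omega)]
      congr 1
      push_cast
      ring
  · intro r hr n hn
    obtain ⟨s, rfl⟩ : ∃ s, r = s + 1 := ⟨r - 1, by omega⟩
    rw [Nat.add_sub_cancel] at hn ⊢
    have key : Nab n (s + 1) = Q s * Δ ((n : ℤ) + 1 - (s + 1 : ℕ)) s := by
      obtain ⟨B, hB0, hB⟩ := exists_coeff_of_unitriangular
        (fun j m => P (s + j) ((m : ℤ) - j)) (fun j m h => hPneg _ _ (by omega))
        (fun j => by simp [hP0]) (fun m => Q (m + s)) d
      have hexp := eq_of_linear_recurrence (d := d) (fun m => X - C (β (m + s)))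
        (fun m ν => C (γ ((m : ℤ) + s - ν) (d - 1 - ν)))
        (f := fun m => Q (m + s))
        (g := fun m => ∑ j ∈ Finset.range (d + 1), B j * P (s + j) ((m : ℤ) - j)) ?_ ?_ hB
      · rw [hNab, hΔ, det_eq_of_col_eq_sum _
          (Matrix.of fun i j : Fin (d + 1) =>
            P (s + (j : ℕ)) ((n : ℤ) + 1 - (s + 1 : ℕ) + (i : ℕ) - (j : ℕ))) 0 (fun j => B j)]
        · simp [hB0]
        · intro t
          have := hexp (n - s + t)
          simp only [Matrix.of_apply, Fin.val_zero, if_true]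
          rw [Fin.sum_univ_eq_sum_range (fun j => B j *
            P (s + j) ((n : ℤ) + 1 - (s + 1 : ℕ) + (t : ℕ) - (j : ℕ)))]
          rw [show n + (t : ℕ) = n - s + t + s by omega, this]
          refine Finset.sum_congr rfl fun j _ => ?_
          congr 2
          omega
        · intro t j hj
          have : (j : ℕ) ≠ 0 := fun h => hj (Fin.ext h)
          simp only [Matrix.of_apply]
          rw [if_neg this]
          congr 1
          · omega
          · push_cast
            ring
      · intro m hm
        have := hQrec (m + s - d)
        rw [show m + s - d + d = m + s by omega, ← Nat.cast_add,
          show m + s - d + d = m + s by omega] at this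
        rw [show m + 1 + s = m + s + 1 by omega, this]
        congr 1
        refine Finset.sum_congr rfl fun ν hν => ?_
        have := Finset.mem_range.1 hν
        rw [show m - 1 - ν + s = m + s - 1 - ν by omega]
        push_cast
        rfl
      · intro m hm
        refine linear_recurrence_sum _ _ _ B (fun j m => P (s + j) ((m : ℤ) - j)) fun j hj => ?_
        have hj := Finset.mem_range.1 hj
        have := hPrec (s + j) (m - j)
        rw [show m - j + (s + j) = m + s by omega] at this
        rw [Nat.cast_sub (by omega)] at this
        rw [show ((m + 1 : ℕ) : ℤ) - j = (m : ℤ) - j + 1 by push_cast; ring, this]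
        congr 1
        refine Finset.sum_congr rfl fun ν hν => ?_
        have := Finset.mem_range.1 hν
        rw [show (m : ℤ) - j + (s + j : ℕ) - ν = (m : ℤ) + s - ν by push_cast; ring,
          show (m : ℤ) - j - 1 - ν = ((m - 1 - ν : ℕ) : ℤ) - j by omega]
    refine ⟨key, ?_⟩
    rw [key, hA s]
    simp
end

section
/- For any integers k > m > n ≥ 0 and r ≥ 0, the determinant of the 3×3 matrix with rows (P_j^{(r)}, P_{j−1}^{(r+1)}, P_{j−2}^{(r+2)}) for j = n, m, k (in this order) equals Δ_n^{(r)} · [ P_{k−m−1}^{(m+r+1)} · ( P_{m−n−1}^{(r+n+1)} P_{m−n−1}^{(r+n+2)} − P_{m−n−2}^{(r+n+2)} P_{m−n}^{(r+n+1)} ) + γ_{m+r}^0 · P_{k−m−2}^{(m+r+2)} · ( P_{m−n−2}^{(r+n+1)} P_{m−n−2}^{(r+n+2)} − P_{m−n−3}^{(r+n+2)} P_{m−n−1}^{(r+n+1)} ) ]. -/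
open Polynomial

/-- The recurrence of the associated polynomials, indexed by the position `t` of its coefficients. -/
lemma associated_rec {β : ℕ → ℂ} {γ1 γ0 : ℤ → ℂ} {P : ℕ → ℤ → Polynomial ℂ}
    (hPrec : ∀ r n : ℕ,
      P r ((n : ℤ) + 1) =
        (X - C (β (n + r))) * P r (n : ℤ) - C (γ1 ((n : ℤ) + r)) * P r ((n : ℤ) - 1)
          - C (γ0 ((n : ℤ) + r - 1)) * P r ((n : ℤ) - 2))
    {u t : ℕ} {i : ℤ} (hi : 0 ≤ i) (ht : i + u = t) :
    P u (i + 1) = (X - C (β t)) * P u i - C (γ1 t) * P u (i - 1)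
      - C (γ0 ((t : ℤ) - 1)) * P u (i - 2) := by
  lift i to ℕ using hi
  obtain rfl : i + u = t := by exact_mod_cast ht
  simpa using hPrec u i

/-- Expansion of `P u` from three consecutive values, with coefficients that are associated
polynomials of higher order. -/
lemma associated_expansion {β : ℕ → ℂ} {γ1 γ0 : ℤ → ℂ} {P : ℕ → ℤ → Polynomial ℂ}
    (hPneg : ∀ (r : ℕ) (n : ℤ), n < 0 → P r n = 0)
    (hP0 : ∀ r : ℕ, P r 0 = 1)
    (hPrec : ∀ r n : ℕ,
      P r ((n : ℤ) + 1) =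
        (X - C (β (n + r))) * P r (n : ℤ) - C (γ1 ((n : ℤ) + r)) * P r ((n : ℤ) - 1)
          - C (γ0 ((n : ℤ) + r - 1)) * P r ((n : ℤ) - 2))
    {u s : ℕ} {e : ℤ} (he : -1 ≤ e) (hs : e + u = s) (p : ℕ) :
    P u (e + p) = P s p * P u e
      + P (s + 1) ((p : ℤ) - 1) * (P u (e + 1) - (X - C (β s)) * P u e)
      - C (γ0 s) * P (s + 2) ((p : ℤ) - 2) * P u (e - 1) := by
  have P_one (v : ℕ) : P v 1 = X - C (β v) := by
    have h := hPrec v 0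
    simpa [hP0, hPneg] using h
  induction p using Nat.strong_induction_on with
  | _ p ih =>
    match p, ih with
    | 0, _ => simp [hP0, hPneg]
    | 1, _ => simp [hP0, hPneg, P_one]
    | 2, _ =>
      have h := associated_rec hPrec (u := u) (t := s + 1) (i := e + 1) (by lia) (by lia)
      have h' := associated_rec hPrec (u := s) (t := s + 1) (i := 1) (by lia) (by lia)
      norm_num [add_assoc, hP0, hPneg, P_one, add_sub_assoc] at h h' ⊢
      rw [h, h', ← sub_eq_add_neg]
      ring
    | p + 3, ih =>
      have h0 := ih p (by lia)
      have h1 := ih (p + 1) (by lia)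
      have h2 := ih (p + 2) (by lia)
      have hu := associated_rec hPrec (u := u) (t := s + p + 2) (i := e + p + 2)
        (by lia) (by push_cast; lia)
      have hs0 := associated_rec hPrec (u := s) (t := s + p + 2) (i := p + 2)
        (by lia) (by push_cast; lia)
      have hs1 := associated_rec hPrec (u := s + 1) (t := s + p + 2) (i := p + 1)
        (by lia) (by push_cast; lia)
      have hs2 := associated_rec hPrec (u := s + 2) (t := s + p + 2) (i := p)
        (by lia) (by push_cast; lia)
      push_cast at h0 h1 h2 ⊢
      ring_nf at h0 h1 h2 hu hs0 hs1 hs2 ⊢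
      rw [hu, hs0, hs1, hs2, h0, h1, h2]
      ring

/-- Evaluation of the determinant `H_m` for 2-orthogonal polynomial sequences (d = 2). -/
theorem twoOPS_Hdet_eval
    (β : ℕ → ℂ) (γ1 γ0 : ℤ → ℂ)
    (hγ1zero : ∀ n : ℤ, n ≤ 0 → γ1 n = 0)
    (hγ0zero : ∀ n : ℤ, n ≤ 0 → γ0 n = 0)
    (hγ0ne : ∀ n : ℤ, 1 ≤ n → γ0 n ≠ 0)
    (P : ℕ → ℤ → Polynomial ℂ)
    (hPneg : ∀ (r : ℕ) (n : ℤ), n < 0 → P r n = 0)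
    (hP0 : ∀ r : ℕ, P r 0 = 1)
    (hPrec : ∀ r n : ℕ,
      P r ((n : ℤ) + 1) =
        (X - C (β (n + r))) * P r (n : ℤ) - C (γ1 ((n : ℤ) + r)) * P r ((n : ℤ) - 1)
          - C (γ0 ((n : ℤ) + r - 1)) * P r ((n : ℤ) - 2))
    (Δ : ℤ → ℕ → Polynomial ℂ)
    (hΔ : ∀ (n : ℤ) (r : ℕ),
      Δ n r = Matrix.det
        (Matrix.of fun i j : Fin 3 => P (r + (j : ℕ)) (n + (i : ℕ) - (j : ℕ))))
    (n m k r : ℕ) (hnm : n < m) (hmk : m < k) :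
    Matrix.det (Matrix.of fun i j : Fin 3 =>
        P (r + (j : ℕ)) ((![(n : ℤ), (m : ℤ), (k : ℤ)] i) - (j : ℕ)))
      = Δ (n : ℤ) r *
          (P (m + r + 1) ((k : ℤ) - m - 1) *
              (P (r + n + 1) ((m : ℤ) - n - 1) * P (r + n + 2) ((m : ℤ) - n - 1)
                - P (r + n + 2) ((m : ℤ) - n - 2) * P (r + n + 1) ((m : ℤ) - n))
            + C (γ0 ((m : ℤ) + r)) * P (m + r + 2) ((k : ℤ) - m - 2) *
              (P (r + n + 1) ((m : ℤ) - n - 2) * P (r + n + 2) ((m : ℤ) - n - 2)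
                - P (r + n + 2) ((m : ℤ) - n - 3) * P (r + n + 1) ((m : ℤ) - n - 1))) := by
  have row {j : ℕ} (hj : n < j) (c : ℕ) (hc : c ≤ 2) :
      P (r + c) ((j : ℤ) - c) = P (r + n + 1) ((j : ℤ) - n - 1) * P (r + c) ((n : ℤ) + 1 - c)
        + P (r + n + 2) ((j : ℤ) - n - 2) * (P (r + c) ((n : ℤ) + 2 - c)
          - (X - C (β (r + n + 1))) * P (r + c) ((n : ℤ) + 1 - c))
        - C (γ0 ((r + n + 1 : ℕ) : ℤ)) * P (r + n + 3) ((j : ℤ) - n - 3)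
          * P (r + c) ((n : ℤ) - c) := by
    have h := associated_expansion hPneg hP0 hPrec (u := r + c) (s := r + n + 1)
      (e := (n : ℤ) + 1 - c) (by lia) (by push_cast; ring) (j - n - 1)
    have hp : ((j - n - 1 : ℕ) : ℤ) = j - n - 1 := by lia
    rw [hp] at h
    convert h using 3 <;> ring_nf
  have tail {v : ℕ} {e : ℤ} (he : 0 ≤ e) (hv : e + v = (m + r + 1 : ℕ)) :
      P v (e + (k - m - 1)) = P (m + r + 1) ((k : ℤ) - m - 1) * P v e
        - P (m + r + 2) ((k : ℤ) - m - 2) * (C (γ1 ((m + r + 1 : ℕ) : ℤ)) * P v (e - 1)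
          + C (γ0 ((m : ℤ) + r)) * P v (e - 2))
        - C (γ0 ((m + r + 1 : ℕ) : ℤ)) * P (m + r + 3) ((k : ℤ) - m - 3) * P v (e - 1) := by
    have h := associated_expansion hPneg hP0 hPrec (by lia) hv (k - m - 1)
    have hp : ((k - m - 1 : ℕ) : ℤ) = k - m - 1 := by lia
    rw [hp, associated_rec hPrec he hv] at h
    rw [h]
    push_cast
    ring_nf
  have hD := tail (v := r + n + 1) (e := (m : ℤ) - n) (by lia) (by push_cast; ring)
  have hC := tail (v := r + n + 2) (e := (m : ℤ) - n - 1) (by lia) (by push_cast; ring)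
  rw [show (m : ℤ) - n + (k - m - 1) = k - n - 1 by ring] at hD
  rw [show (m : ℤ) - n - 1 + (k - m - 1) = k - n - 2 by ring,
    show (m : ℤ) - n - 1 - 1 = m - n - 2 by ring,
    show (m : ℤ) - n - 1 - 2 = m - n - 3 by ring] at hC
  have m0 := row hnm 0 (by lia)
  have m1 := row hnm 1 (by lia)
  have m2 := row hnm 2 (by lia)
  have k0 := row (hnm.trans hmk) 0 (by lia)
  have k1 := row (hnm.trans hmk) 1 (by lia)
  have k2 := row (hnm.trans hmk) 2 (by lia)
  rw [hC, hD] at k0 k1 k2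
  rw [hΔ, Matrix.det_fin_three, Matrix.det_fin_three]
  simp only [Matrix.of_apply, Fin.val_zero, Fin.val_one, Fin.val_two, Matrix.cons_val]
  rw [m0, m1, m2, k0, k1, k2]
  push_cast
  simp only [add_zero]
  ring
end

section
/- Let k ≥ 0 be an integer and let (Q_n)_{n≥0} be polynomials in ℂ[x] such that Q_n = P_n for 0 ≤ n ≤ k and Q_{m+d+1}(x) = (x − β_{m+d}) Q_{m+d}(x) − Σ_{ν=0}^{d−1} γ_{m+d−ν}^{d−1−ν} Q_{m+d−1−ν}(x) for all m ≥ k (the polynomials Q_{k+1}, …, Q_{k+d} being arbitrary). Then there exist polynomials A_1, …, A_d ∈ ℂ[x] such that Q_n(x) = P_n(x) − Σ_{i=1}^{d} A_i(x) · P_{n−k−i}^{(k+i)}(x) for every n ≥ 0. -/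
open Polynomial

/-- A sequence agreeing with `p` up to `k` can be matched up to `k + j` by subtracting a
combination of `j` sequences, the `i`-th of which starts with `1` at the index `k + i`. -/
lemma exists_triangular_expansion {R : Type*} [CommRing R] (P : ℕ → ℤ → R)
    (hPneg : ∀ (r : ℕ) (n : ℤ), n < 0 → P r n = 0) (hP0 : ∀ r : ℕ, P r 0 = 1)
    (k : ℕ) (q p : ℕ → R) (hq : ∀ n ≤ k, q n = p n) (j : ℕ) :
    ∃ A : ℕ → R, ∀ n ≤ k + j,
      q n = p n - ∑ i ∈ Finset.Icc 1 j, A i * P (k + i) ((n : ℤ) - k - i) := by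
  induction j with
  | zero => exact ⟨0, fun n hn => by simpa using hq n hn⟩
  | succ j ih =>
    obtain ⟨A, hA⟩ := ih
    refine ⟨Function.update A (j + 1) (p (k + (j + 1)) - q (k + (j + 1)) -
      ∑ i ∈ Finset.Icc 1 j, A i * P (k + i) (((k + (j + 1) : ℕ) : ℤ) - k - i)), fun n hn => ?_⟩
    rw [Finset.sum_Icc_succ_top (by omega), Function.update_self]
    have hsum (a : R) : ∑ i ∈ Finset.Icc 1 j,
        Function.update A (j + 1) a i * P (k + i) ((n : ℤ) - k - i) =
        ∑ i ∈ Finset.Icc 1 j, A i * P (k + i) ((n : ℤ) - k - i) := by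
      refine Finset.sum_congr rfl fun i hi => ?_
      rw [Function.update_of_ne (by have := Finset.mem_Icc.mp hi; omega)]
    rw [hsum]
    rcases hn.lt_or_eq with hlt | rfl
    · rw [hPneg (k + (j + 1)) _ (by omega), hA n (by omega)]
      ring
    · have hzero : ((k + (j + 1) : ℕ) : ℤ) - k - (j + 1 : ℕ) = 0 := by omega
      rw [hzero, hP0]
      ring

/-- General solution of the generalized co-recursive recurrence in terms of associated
polynomials. -/
theorem dOPS_corecursive_expansion
    (d : ℕ) (hd : 1 ≤ d)
    (β : ℕ → ℂ) (γ : ℤ → ℕ → ℂ)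
    (hγzero : ∀ n : ℤ, n ≤ 0 → ∀ ν : ℕ, γ n ν = 0)
    (hγne : ∀ n : ℤ, 1 ≤ n → γ n 0 ≠ 0)
    (P : ℕ → ℤ → Polynomial ℂ)
    (hPneg : ∀ (r : ℕ) (n : ℤ), n < 0 → P r n = 0)
    (hP0 : ∀ r : ℕ, P r 0 = 1)
    (hPrec : ∀ r n : ℕ,
      P r ((n : ℤ) + 1) =
        (X - C (β (n + r))) * P r (n : ℤ) -
          ∑ ν ∈ Finset.range d, C (γ ((n : ℤ) + r - ν) (d - 1 - ν)) * P r ((n : ℤ) - 1 - ν))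
    (k : ℕ) (Q : ℕ → Polynomial ℂ)
    (hQk : ∀ n : ℕ, n ≤ k → Q n = P 0 (n : ℤ))
    (hQrec : ∀ m : ℕ, k ≤ m →
      Q (m + d + 1) =
        (X - C (β (m + d))) * Q (m + d) -
          ∑ ν ∈ Finset.range d, C (γ ((m : ℤ) + d - ν) (d - 1 - ν)) * Q (m + d - 1 - ν)) :
    ∃ A : ℕ → Polynomial ℂ,
      ∀ n : ℕ, Q n = P 0 (n : ℤ) - ∑ i ∈ Finset.Icc 1 d, A i * P (k + i) ((n : ℤ) - k - i) := by
  obtain ⟨A, hA⟩ := exists_triangular_expansion P hPneg hP0 k Q (fun n => P 0 n) hQk d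
  refine ⟨A, fun n => ?_⟩
  induction n using Nat.strong_induction_on with
  | _ n ih =>
    rcases le_or_gt n (k + d) with hn | hn
    · exact hA n hn
    obtain ⟨m, rfl⟩ : ∃ m, n = m + d + 1 := ⟨n - d - 1, by omega⟩
    have hkm : k ≤ m := by omega
    have hP : P 0 ((m + d + 1 : ℕ) : ℤ) = (X - C (β (m + d))) * P 0 ((m + d : ℕ) : ℤ) -
        ∑ ν ∈ Finset.range d, C (γ ((m : ℤ) + d - ν) (d - 1 - ν)) *
          P 0 ((m + d - 1 - ν : ℕ) : ℤ) := by
      have h := hPrec 0 (m + d)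
      rw [Nat.cast_succ, h]
      congr 1
      refine Finset.sum_congr rfl fun ν hν => ?_
      have hν := Finset.mem_range.mp hν
      congr 3; push_cast; omega
    have hPi : ∀ i ∈ Finset.Icc 1 d, P (k + i) (((m + d + 1 : ℕ) : ℤ) - k - i) =
        (X - C (β (m + d))) * P (k + i) (((m + d : ℕ) : ℤ) - k - i) -
        ∑ ν ∈ Finset.range d, C (γ ((m : ℤ) + d - ν) (d - 1 - ν)) *
          P (k + i) (((m + d - 1 - ν : ℕ) : ℤ) - k - i) := by
      intro i hi
      have hi := Finset.mem_Icc.mp hi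
      have h := hPrec (k + i) (m + d - k - i)
      have e₁ : ((m + d - k - i : ℕ) : ℤ) = ((m + d : ℕ) : ℤ) - k - i := by omega
      have e₂ : ((m + d + 1 : ℕ) : ℤ) - k - i = ((m + d : ℕ) : ℤ) - k - i + 1 := by omega
      have e₃ : m + d - k - i + (k + i) = m + d := by omega
      rw [e₁, e₃] at h
      rw [e₂, h]
      congr 1
      refine Finset.sum_congr rfl fun ν hν => ?_
      have hν := Finset.mem_range.mp hν
      have e₄ : ((m + d : ℕ) : ℤ) - k - i + (k + i : ℕ) - ν = (m : ℤ) + d - ν := by omega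
      have e₅ : ((m + d : ℕ) : ℤ) - k - i - 1 - ν = ((m + d - 1 - ν : ℕ) : ℤ) - k - i := by omega
      rw [e₄, e₅]
    have hQ : ∀ ν ∈ Finset.range d, C (γ ((m : ℤ) + d - ν) (d - 1 - ν)) * Q (m + d - 1 - ν) =
        C (γ ((m : ℤ) + d - ν) (d - 1 - ν)) * (P 0 ((m + d - 1 - ν : ℕ) : ℤ) -
          ∑ i ∈ Finset.Icc 1 d, A i * P (k + i) (((m + d - 1 - ν : ℕ) : ℤ) - k - i)) :=
      fun ν _ => by rw [ih (m + d - 1 - ν) (by omega)]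
    rw [hQrec m hkm, ih (m + d) (by omega), Finset.sum_congr rfl hQ, hP,
      Finset.sum_congr rfl fun i hi => congrArg (A i * ·) (hPi i hi)]
    simp only [mul_sub, Finset.sum_sub_distrib, Finset.mul_sum]
    rw [Finset.sum_comm (s := Finset.range d)]
    simp only [mul_left_comm (A _)]
    ring
end

section
/- Let k ≥ 1 be an integer and λ ∈ ℂ, and define the level-k co-dilated sequence (P̃_n)_{n≥0} by: P̃_n = P_n for 0 ≤ n ≤ d+k−1; P̃_{d+k}(x) = (x − β_{d+k−1}) P̃_{d+k−1}(x) − Σ_{ν=0}^{d−2} γ_{d+k−1−ν}^{d−1−ν} P̃_{d+k−2−ν}(x) − λ γ_k^0 P̃_{k−1}(x); and P̃_{m+d+1}(x) = (x − β_{m+d}) P̃_{m+d}(x) − Σ_{ν=0}^{d−1} γ_{m+d−ν}^{d−1−ν} P̃_{m+d−1−ν}(x) for all m ≥ k. Then P̃_n(x) = P_n(x) + (1 − λ) γ_k^0 P_{k−1}(x) · P_{n−(d+k)}^{(d+k)}(x) for every n ≥ 0. -/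
open Polynomial

/-- General solution of the level-k co-dilated recurrence. -/
theorem dOPS_codilated_expansion
    (d : ℕ) (hd : 1 ≤ d)
    (β : ℕ → ℂ) (γ : ℤ → ℕ → ℂ)
    (hγzero : ∀ n : ℤ, n ≤ 0 → ∀ ν : ℕ, γ n ν = 0)
    (hγne : ∀ n : ℤ, 1 ≤ n → γ n 0 ≠ 0)
    (P : ℕ → ℤ → Polynomial ℂ)
    (hPneg : ∀ (r : ℕ) (n : ℤ), n < 0 → P r n = 0)
    (hP0 : ∀ r : ℕ, P r 0 = 1)
    (hPrec : ∀ r n : ℕ,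
      P r ((n : ℤ) + 1) =
        (X - C (β (n + r))) * P r (n : ℤ) -
          ∑ ν ∈ Finset.range d, C (γ ((n : ℤ) + r - ν) (d - 1 - ν)) * P r ((n : ℤ) - 1 - ν))
    (k : ℕ) (hk : 1 ≤ k) (lam : ℂ) (Pt : ℕ → Polynomial ℂ)
    (hPt1 : ∀ n : ℕ, n ≤ d + k - 1 → Pt n = P 0 (n : ℤ))
    (hPt2 : Pt (d + k) =
      (X - C (β (d + k - 1))) * Pt (d + k - 1) -
        (∑ ν ∈ Finset.range (d - 1),
          C (γ ((d : ℤ) + k - 1 - ν) (d - 1 - ν)) * Pt (d + k - 2 - ν)) -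
        C (lam * γ (k : ℤ) 0) * Pt (k - 1))
    (hPt3 : ∀ m : ℕ, k ≤ m →
      Pt (m + d + 1) =
        (X - C (β (m + d))) * Pt (m + d) -
          ∑ ν ∈ Finset.range d, C (γ ((m : ℤ) + d - ν) (d - 1 - ν)) * Pt (m + d - 1 - ν)) :
    ∀ n : ℕ,
      Pt n = P 0 (n : ℤ) +
        C ((1 - lam) * γ (k : ℤ) 0) * P 0 ((k : ℤ) - 1) * P (d + k) ((n : ℤ) - (d + k)) := by
  obtain ⟨e, rfl⟩ : ∃ e, d = e + 1 := ⟨d - 1, by omega⟩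
  obtain ⟨j, rfl⟩ : ∃ j, k = j + 1 := ⟨k - 1, by omega⟩
  intro n
  induction n using Nat.strong_induction_on with
  | _ n ih =>
    rcases lt_trichotomy n (e + 1 + (j + 1)) with hn | rfl | hn
    · rw [hPt1 n (by omega), hPneg (e + 1 + (j + 1)) _ (by push_cast; omega)]
      simp
    · have hP := hPrec 0 (e + j + 1)
      rw [Finset.sum_range_succ] at hP
      have hsum : ∑ ν ∈ Finset.range (e + 1 - 1),
            C (γ (((e + 1 : ℕ) : ℤ) + (j + 1 : ℕ) - 1 - ν) (e + 1 - 1 - ν)) *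
              Pt (e + 1 + (j + 1) - 2 - ν) =
          ∑ ν ∈ Finset.range e,
            C (γ (((e + j + 1 : ℕ) : ℤ) + (0 : ℕ) - ν) (e + 1 - 1 - ν)) *
              P 0 (((e + j + 1 : ℕ) : ℤ) - 1 - ν) := by
        refine Finset.sum_congr (by simp) fun ν hν => ?_
        have hν' := Finset.mem_range.mp hν
        rw [hPt1 _ (by omega)]
        congr 3 <;> grind
      have hγ : ((e + j + 1 : ℕ) : ℤ) + (0 : ℕ) - e = ((j + 1 : ℕ) : ℤ) := by push_cast; ring
      have hj : ((e + j + 1 : ℕ) : ℤ) - 1 - e = (j : ℤ) := by push_cast; ring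
      have hβ : e + 1 + (j + 1) - 1 = e + j + 1 := by omega
      have hn : ((e + 1 + (j + 1) : ℕ) : ℤ) = ((e + j + 1 : ℕ) : ℤ) + 1 := by push_cast; ring
      have hj' : ((j + 1 : ℕ) : ℤ) - 1 = (j : ℤ) := by push_cast; ring
      have hzero : ((e + 1 + (j + 1) : ℕ) : ℤ) - (((e + 1 : ℕ) : ℤ) + (j + 1 : ℕ)) = 0 := by
        push_cast; ring
      rw [hPt2, hsum, hzero, hP0, hn, hP, hγ, hj, hj', hβ, hPt1 (e + j + 1) (by omega),
        hPt1 (j + 1 - 1) (by omega)]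
      simp only [Nat.add_sub_cancel, Nat.sub_self, C_mul, C_sub, C_1, Nat.add_zero]
      ring
    · obtain ⟨l, rfl⟩ : ∃ l, n = (l + (j + 1)) + (e + 1) + 1 :=
        ⟨n - (j + 1 + (e + 1) + 1), by omega⟩
      set c := C ((1 - lam) * γ ((j + 1 : ℕ) : ℤ) 0) * P 0 (((j + 1 : ℕ) : ℤ) - 1)
      have hP := hPrec 0 (l + (j + 1) + (e + 1))
      have hQ := hPrec (e + 1 + (j + 1)) l
      have hsum : ∑ ν ∈ Finset.range (e + 1),
            C (γ (((l + (j + 1) : ℕ) : ℤ) + (e + 1 : ℕ) - ν) (e + 1 - 1 - ν)) *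
              Pt (l + (j + 1) + (e + 1) - 1 - ν) =
          (∑ ν ∈ Finset.range (e + 1),
            C (γ (((l + (j + 1) + (e + 1) : ℕ) : ℤ) + (0 : ℕ) - ν) (e + 1 - 1 - ν)) *
              P 0 (((l + (j + 1) + (e + 1) : ℕ) : ℤ) - 1 - ν)) +
          c * ∑ ν ∈ Finset.range (e + 1),
            C (γ ((l : ℤ) + (e + 1 + (j + 1) : ℕ) - ν) (e + 1 - 1 - ν)) *
              P (e + 1 + (j + 1)) ((l : ℤ) - 1 - ν) := by
        rw [Finset.mul_sum, ← Finset.sum_add_distrib]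
        refine Finset.sum_congr rfl fun ν hν => ?_
        have hν' := Finset.mem_range.mp hν
        have h₁ : ((l + (j + 1) + (e + 1) - 1 - ν : ℕ) : ℤ) =
          ((l + (j + 1) + (e + 1) : ℕ) : ℤ) - 1 - ν := by omega
        have h₂ : ((l + (j + 1) + (e + 1) : ℕ) : ℤ) - 1 - ν -
          (((e + 1 : ℕ) : ℤ) + (j + 1 : ℕ)) = (l : ℤ) - 1 - ν := by push_cast; ring
        have h₃ : ((l + (j + 1) + (e + 1) : ℕ) : ℤ) + (0 : ℕ) - ν =
          ((l + (j + 1) : ℕ) : ℤ) + (e + 1 : ℕ) - ν := by push_cast; ring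
        have h₄ : (l : ℤ) + (e + 1 + (j + 1) : ℕ) - ν =
          ((l + (j + 1) : ℕ) : ℤ) + (e + 1 : ℕ) - ν := by push_cast; ring
        rw [ih _ (by omega), h₁, h₂, h₃, h₄]
        ring
      have hn : ((l + (j + 1) + (e + 1) + 1 : ℕ) : ℤ) =
        ((l + (j + 1) + (e + 1) : ℕ) : ℤ) + 1 := by push_cast; ring
      have hl : ((l + (j + 1) + (e + 1) : ℕ) : ℤ) + 1 - (((e + 1 : ℕ) : ℤ) + (j + 1 : ℕ)) =
        (l : ℤ) + 1 := by push_cast; ring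
      have hl' : ((l + (j + 1) + (e + 1) : ℕ) : ℤ) - (((e + 1 : ℕ) : ℤ) + (j + 1 : ℕ)) =
        (l : ℤ) := by push_cast; ring
      have hβ : l + (e + 1 + (j + 1)) = l + (j + 1) + (e + 1) := by ring
      rw [hPt3 _ (by omega), hsum, ih (l + (j + 1) + (e + 1)) (by omega), hn, hl, hl', hP, hQ,
        hβ, add_zero]
      ring
end

section
/- Assume P_n(0) ≠ 0 for all n ≥ 1. Define numbers m_n and l_{a,b} (with the convention l_{a,b} := 0 unless b ≤ a ≤ b+d−1) by: m_1 = β_0; l_{i,1} = γ_1^{d−i}/m_1 for 1 ≤ i ≤ d; and recursively for n ≥ 1, m_{n+1} = β_n − l_{n,n} and l_{n+i,n+1} = (γ_{n+1}^{d−i} − l_{n+i,n})/m_{n+1} for 1 ≤ i ≤ d (these are the entries of the LU factorization of the monic Jacobi matrix of (P_n)). Then this recursion is well defined, i.e. m_n ≠ 0 for every n ≥ 1, and moreover m_n = − P_n(0)/P_{n−1}(0) for every n ≥ 1. -/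
open Polynomial

/-- Well-definedness of the LU factorization of the monic Jacobi matrix of a d-OPS, and the
formula `m_n = -P_n(0)/P_{n-1}(0)`. -/
theorem dOPS_LU_pivot_formula
    (d : ℕ) (hd : 1 ≤ d)
    (β : ℕ → ℂ) (γ : ℤ → ℕ → ℂ)
    (hγzero : ∀ n : ℤ, n ≤ 0 → ∀ ν : ℕ, γ n ν = 0)
    (hγne : ∀ n : ℤ, 1 ≤ n → γ n 0 ≠ 0)
    (P : ℕ → ℤ → Polynomial ℂ)
    (hPneg : ∀ (r : ℕ) (n : ℤ), n < 0 → P r n = 0)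
    (hP0 : ∀ r : ℕ, P r 0 = 1)
    (hPrec : ∀ r n : ℕ,
      P r ((n : ℤ) + 1) =
        (X - C (β (n + r))) * P r (n : ℤ) -
          ∑ ν ∈ Finset.range d, C (γ ((n : ℤ) + r - ν) (d - 1 - ν)) * P r ((n : ℤ) - 1 - ν))
    (hPzero : ∀ n : ℕ, 1 ≤ n → Polynomial.eval 0 (P 0 (n : ℤ)) ≠ 0)
    (mseq : ℕ → ℂ) (l : ℕ → ℕ → ℂ)
    (hlconv : ∀ a b : ℕ, ¬(b ≤ a ∧ a ≤ b + d - 1) → l a b = 0)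
    (hm1 : mseq 1 = β 0)
    (hl1 : ∀ i : ℕ, 1 ≤ i → i ≤ d → l i 1 = γ 1 (d - i) / mseq 1)
    (hmrec : ∀ n : ℕ, 1 ≤ n → mseq (n + 1) = β n - l n n)
    (hlrec : ∀ n : ℕ, 1 ≤ n → ∀ i : ℕ, 1 ≤ i → i ≤ d →
      l (n + i) (n + 1) = (γ ((n : ℤ) + 1) (d - i) - l (n + i) n) / mseq (n + 1)) :
    ∀ n : ℕ, 1 ≤ n →
      mseq n ≠ 0 ∧
        mseq n = -Polynomial.eval 0 (P 0 (n : ℤ)) / Polynomial.eval 0 (P 0 ((n : ℤ) - 1)) := by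
  set p : ℕ → ℂ := fun k => (P 0 (k : ℤ)).eval 0 with hp
  have p_ne : ∀ k, p k ≠ 0 := fun k => by
    rcases Nat.eq_zero_or_pos k with rfl | hk
    · simp [hp, hP0]
    · exact hPzero k hk
  have p_rec : ∀ n : ℕ, p (n + 1) = -β n * p n -
      ∑ ν ∈ Finset.range d, γ ((n : ℤ) - ν) (d - 1 - ν) * (P 0 ((n : ℤ) - 1 - ν)).eval 0 := by
    intro n
    have h := congrArg (Polynomial.eval 0) (hPrec 0 n)
    simpa [eval_finsetSum, hp] using h
  have pivot : ∀ n : ℕ, p (n + 1) = -mseq (n + 1) * p n := by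
    intro n
    induction n using Nat.strong_induction_on with
    | _ n ih =>
    have m_ne : ∀ k < n, mseq (k + 1) ≠ 0 := fun k hk h0 =>
      p_ne (k + 1) (by rw [ih k hk, h0]; simp)
    -- The row `n` of the product `LU` telescopes against the values `p`.
    set f : ℕ → ℂ := fun ν => if n - ν = 0 then 0 else l n (n - ν) * p (n - ν) with hf
    have hterm : ∀ ν ∈ Finset.range d,
        γ ((n : ℤ) - ν) (d - 1 - ν) * (P 0 ((n : ℤ) - 1 - ν)).eval 0 = f (ν + 1) - f ν := by
      intro ν hν
      have hνd := Finset.mem_range.mp hν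
      by_cases hn : n ≤ ν
      · have h1 : n - ν = 0 := by omega
        have h2 : n - (ν + 1) = 0 := by omega
        rw [hγzero _ (by omega)]
        simp [hf, h1, h2]
      · obtain ⟨b, rfl⟩ : ∃ b, n = b + (ν + 1) := ⟨n - (ν + 1), by omega⟩
        have h1 : b + (ν + 1) - ν = b + 1 := by omega
        have h2 : b + (ν + 1) - (ν + 1) = b := by omega
        have h3 : ((b + (ν + 1) : ℕ) : ℤ) - ν = (b : ℤ) + 1 := by push_cast; ring
        have h4 : ((b + (ν + 1) : ℕ) : ℤ) - 1 - ν = (b : ℤ) := by push_cast; ring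
        have h5 : d - 1 - ν = d - (ν + 1) := by omega
        have hm := m_ne b (by omega)
        have hpb := ih b (by omega)
        simp only [hf, h1, h2, h3, h4, h5]
        change _ * p b = _
        rw [hpb]
        rcases Nat.eq_zero_or_pos b with rfl | hb
        · have hl := hl1 (ν + 1) (by omega) (by omega)
          simp only [zero_add] at hl hm ⊢
          rw [hl]
          simp
          field_simp
        · rw [hlrec b hb (ν + 1) (by omega) (by omega)]
          simp only [hb.ne', if_false, Nat.add_eq_zero_iff, false_and]
          field_simp
          ring
    rw [p_rec, Finset.sum_congr rfl hterm, Finset.sum_range_sub]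
    have hfd : f d = 0 := by
      by_cases h : n - d = 0
      · simp [hf, h]
      · simp [hf, hlconv n (n - d) (by omega)]
    rw [hfd]
    rcases Nat.eq_zero_or_pos n with rfl | hn
    · simp [hf, hm1]
    · rw [hmrec n hn]
      simp only [hf, Nat.sub_zero, hn.ne', if_false]
      ring
  intro n hn
  obtain ⟨k, rfl⟩ : ∃ k, n = k + 1 := ⟨n - 1, by omega⟩
  have hk : ((k + 1 : ℕ) : ℤ) - 1 = (k : ℤ) := by push_cast; ring
  rw [hk]
  change _ ∧ _ = -p (k + 1) / p k
  refine ⟨fun h0 => p_ne (k + 1) (by rw [pivot k, h0]; simp), ?_⟩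
  rw [eq_div_iff (p_ne k), pivot k]
  ring
end

section
/- Assume P_n(0) ≠ 0 for all n ≥ 1, and for n ≥ 0 define the kernel polynomial K_n ∈ ℂ[x] by x·K_n(x) = P_{n+1}(x) − (P_{n+1}(0)/P_n(0))·P_n(x) (the right-hand side vanishes at 0, so K_n is well defined); set K_n := 0 for n < 0. Then: (i) each K_n is monic of degree n; (ii) for every n ≥ 0 there exist complex numbers c_{n,1}, …, c_{n,d} such that P_n = K_n + Σ_{i=1}^{d} c_{n,i} K_{n−i}; (iii) there exist complex numbers β̃_n (n ≥ 0) and γ̃_n^ν (with γ̃_n^ν := 0 for n ≤ 0) such that K_{n+1}(x) = (x − β̃_n) K_n(x) − Σ_{ν=0}^{d−1} γ̃_{n−ν}^{d−1−ν} K_{n−1−ν}(x) for all n ≥ 0, i.e. (K_n) satisfies a (d+2)-term recurrence of the same form as (P_n). -/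
open Polynomial

/-- A sequence of polynomials satisfying a finite-order recurrence whose leading term is
`(X - C b) * p n` is monic of degree equal to its index. -/
theorem monic_natDegree_of_recurrence (d : ℕ) (p : ℤ → ℂ[X]) (b : ℕ → ℂ) (g : ℕ → ℕ → ℂ)
    (hneg : ∀ n : ℤ, n < 0 → p n = 0) (h0 : p 0 = 1)
    (hrec : ∀ n : ℕ, p ((n : ℤ) + 1) =
      (X - C (b n)) * p n - ∑ ν ∈ Finset.range d, C (g n ν) * p ((n : ℤ) - 1 - ν)) (n : ℕ) :
    (p n).Monic ∧ (p n).natDegree = n := by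
  induction n using Nat.strong_induction_on with
  | _ n ih =>
    rcases n with _ | n
    · simp [h0]
    · obtain ⟨hm, hdeg⟩ := ih n n.lt_succ_self
      have hm' : ((X - C (b n)) * p n).Monic := (monic_X_sub_C _).mul hm
      have hdeg' : ((X - C (b n)) * p n).natDegree = n + 1 := by
        rw [(monic_X_sub_C _).natDegree_mul hm, natDegree_X_sub_C, hdeg, add_comm]
      have hlow : ∑ ν ∈ Finset.range d, C (g n ν) * p ((n : ℤ) - 1 - ν) ∈
          degreeLT ℂ (n + 1) := by
        refine Submodule.sum_mem _ fun ν _ => ?_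
        rw [← smul_eq_C_mul]
        refine Submodule.smul_mem _ _ ?_
        by_cases h : (n : ℤ) - 1 - ν < 0
        · rw [hneg _ h]
          exact Submodule.zero_mem _
        · obtain ⟨k, hk⟩ := Int.eq_ofNat_of_zero_le (not_lt.mp h)
          have hkn : k < n + 1 := by omega
          obtain ⟨hkm, hkd⟩ := ih k hkn
          rw [hk, mem_degreeLT, degree_eq_natDegree hkm.ne_zero, hkd]
          exact_mod_cast hkn
      have hlt : (∑ ν ∈ Finset.range d, C (g n ν) * p ((n : ℤ) - 1 - ν)).degree <
          ((X - C (b n)) * p n).degree := by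
        rw [degree_eq_natDegree hm'.ne_zero, hdeg']
        exact mem_degreeLT.mp hlow
      push_cast
      rw [hrec n]
      exact ⟨hm'.sub_of_left hlt, by
        rw [natDegree_eq_of_degree_eq (degree_sub_eq_left_of_degree_lt hlt), hdeg']⟩

/-- A combination of `p n, …, p (n - m)` that vanishes at `0` is `X` times a combination of
the kernel polynomials `K (n - 1), …, K (n - m)`. -/
theorem exists_eq_X_mul_sum_kernel (p K : ℤ → ℂ[X]) (ρ : ℕ → ℂ)
    (hneg : ∀ n : ℤ, n < 0 → p n = 0) (hp : ∀ n : ℕ, eval 0 (p n) ≠ 0)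
    (hK : ∀ n : ℕ, X * K n = p ((n : ℤ) + 1) - C (ρ n) * p n)
    (m : ℕ) (n : ℤ) (e : ℕ → ℂ)
    (he : eval 0 (∑ i ∈ Finset.range (m + 1), C (e i) * p (n - i)) = 0) :
    ∃ c : ℕ → ℂ, ∑ i ∈ Finset.range (m + 1), C (e i) * p (n - i) =
      X * ∑ i ∈ Finset.range m, C (c i) * K (n - 1 - i) := by
  induction m generalizing n e with
  | zero =>
    refine ⟨0, ?_⟩
    by_cases h : n < 0
    · simp [hneg n h]
    · obtain ⟨k, rfl⟩ := Int.eq_ofNat_of_zero_le (not_lt.mp h)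
      have h0 : e 0 = 0 := by simpa [hp k] using he
      simp [h0]
  | succ m ih =>
    by_cases h : n < 1
    · have hs : ∑ i ∈ Finset.range (m + 1 + 1), C (e i) * p (n - i) = C (e 0) * p n := by
        rw [Finset.sum_range_succ', Finset.sum_eq_zero fun i _ => ?_]
        · simp
        · rw [hneg _ (by push_cast; omega), mul_zero]
      refine ⟨0, ?_⟩
      rw [hs] at he ⊢
      by_cases h' : n < 0
      · simp [hneg n h']
      · obtain ⟨k, rfl⟩ := Int.eq_ofNat_of_zero_le (not_lt.mp h')
        have h0 : e 0 = 0 := by simpa [hp k] using he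
        simp [h0]
    · obtain ⟨k, hk⟩ := Int.eq_ofNat_of_zero_le (show 0 ≤ n - 1 by omega)
      obtain rfl : n = (k : ℤ) + 1 := by omega
      have hs : ∑ i ∈ Finset.range (m + 1 + 1), C (e i) * p ((k : ℤ) + 1 - i) =
          X * (C (e 0) * K k) + ∑ i ∈ Finset.range (m + 1),
            C (if i = 0 then e 1 + e 0 * ρ k else e (i + 1)) * p ((k : ℤ) - i) := by
        rw [Finset.sum_range_succ', Finset.sum_range_succ', Finset.sum_range_succ' _ m]
        have hshift : ∀ i : ℕ, (k : ℤ) + 1 - (i + 1 + 1) = k - (i + 1) := fun i => by ring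
        simp only [Nat.cast_add, Nat.cast_one, Nat.cast_zero, hshift, sub_zero, zero_add,
          add_sub_cancel_right, Nat.add_eq_zero_iff, one_ne_zero, and_false, if_false, if_true,
          C_add, C_mul]
        linear_combination (-C (e 0)) * hK k
      rw [hs] at he ⊢
      obtain ⟨c, hc⟩ := ih k _ (by simpa only [eval_add, eval_mul, eval_X, zero_mul,
        zero_add] using he)
      refine ⟨fun i => if i = 0 then e 0 else c (i - 1), ?_⟩
      rw [hc, Finset.sum_range_succ', ← mul_add]
      have hshift : ∀ i : ℕ, (k : ℤ) - (i + 1) = k - 1 - i := fun i => by ring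
      simp [hshift, add_comm]

/-- Kernel polynomials of a d-OPS: monicity, d-quasi-orthogonality expansion, and the
(d+2)-term recurrence. -/
theorem dOPS_kernel_polynomials
    (d : ℕ) (hd : 1 ≤ d)
    (β : ℕ → ℂ) (γ : ℤ → ℕ → ℂ)
    (hγzero : ∀ n : ℤ, n ≤ 0 → ∀ ν : ℕ, γ n ν = 0)
    (hγne : ∀ n : ℤ, 1 ≤ n → γ n 0 ≠ 0)
    (P : ℕ → ℤ → Polynomial ℂ)
    (hPneg : ∀ (r : ℕ) (n : ℤ), n < 0 → P r n = 0)
    (hP0 : ∀ r : ℕ, P r 0 = 1)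
    (hPrec : ∀ r n : ℕ,
      P r ((n : ℤ) + 1) =
        (X - C (β (n + r))) * P r (n : ℤ) -
          ∑ ν ∈ Finset.range d, C (γ ((n : ℤ) + r - ν) (d - 1 - ν)) * P r ((n : ℤ) - 1 - ν))
    (hPzero : ∀ n : ℕ, 1 ≤ n → Polynomial.eval 0 (P 0 (n : ℤ)) ≠ 0)
    (K : ℤ → Polynomial ℂ)
    (hKneg : ∀ n : ℤ, n < 0 → K n = 0)
    (hK : ∀ n : ℕ,
      X * K (n : ℤ) =
        P 0 ((n : ℤ) + 1) -
          C (Polynomial.eval 0 (P 0 ((n : ℤ) + 1)) / Polynomial.eval 0 (P 0 (n : ℤ))) *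
            P 0 (n : ℤ)) :
    (∀ n : ℕ, (K (n : ℤ)).Monic ∧ (K (n : ℤ)).natDegree = n)
    ∧ (∀ n : ℕ, ∃ c : ℕ → ℂ,
        P 0 (n : ℤ) = K (n : ℤ) + ∑ i ∈ Finset.Icc 1 d, C (c i) * K ((n : ℤ) - i))
    ∧ (∃ βt : ℕ → ℂ, ∃ γt : ℤ → ℕ → ℂ,
        (∀ nn : ℤ, nn ≤ 0 → ∀ ν : ℕ, γt nn ν = 0) ∧
          ∀ n : ℕ,
            K ((n : ℤ) + 1) =
              (X - C (βt n)) * K (n : ℤ) -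
                ∑ ν ∈ Finset.range d, C (γt ((n : ℤ) - ν) (d - 1 - ν)) * K ((n : ℤ) - 1 - ν)) := by
  have hp : ∀ n : ℕ, eval 0 (P 0 n) ≠ 0 := fun n => by
    rcases n with _ | n
    · simp [hP0]
    · exact hPzero _ n.succ_pos
  have hrec : ∀ n : ℕ, P 0 ((n : ℤ) + 1) = (X - C (β n)) * P 0 n -
      ∑ ν ∈ Finset.range d, C (γ ((n : ℤ) - ν) (d - 1 - ν)) * P 0 ((n : ℤ) - 1 - ν) :=
    fun n => by simpa using hPrec 0 n
  have hmonic := monic_natDegree_of_recurrence d (P 0) β _ (hPneg 0) (hP0 0) hrec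
  set ρ : ℕ → ℂ := fun n => eval 0 (P 0 ((n : ℤ) + 1)) / eval 0 (P 0 n) with hρ
  replace hK : ∀ n : ℕ, X * K n = P 0 ((n : ℤ) + 1) - C (ρ n) * P 0 n := hK
  have hquasi : ∀ n : ℕ, ∃ c : ℕ → ℂ, P 0 (n : ℤ) =
      K n + ∑ i ∈ Finset.range d, C (c i) * K ((n : ℤ) - 1 - i) := fun n => by
    have hs : X * (P 0 n - K n) = ∑ i ∈ Finset.range (d + 1),
        C (if i = 0 then β n + ρ n else γ ((n : ℤ) - (i - 1 : ℕ)) (d - 1 - (i - 1))) *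
          P 0 ((n : ℤ) - i) := by
      rw [Finset.sum_range_succ']
      have hshift : ∀ i : ℕ, (n : ℤ) - (i + 1) = n - 1 - i := fun i => by ring
      simp only [Nat.cast_add, Nat.cast_one, Nat.cast_zero, hshift, sub_zero,
        Nat.add_eq_zero_iff, one_ne_zero, and_false, if_false, if_true, C_add,
        Nat.add_sub_cancel]
      linear_combination -hrec n - hK n
    obtain ⟨c, hc⟩ := exists_eq_X_mul_sum_kernel (P 0) K ρ (hPneg 0) hp hK d n _
      (by rw [← hs]; simp)
    refine ⟨c, ?_⟩
    rw [← hs] at hc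
    linear_combination mul_left_cancel₀ X_ne_zero hc
  refine ⟨fun n => ?_, fun n => ?_, ?_⟩
  · obtain ⟨hm, hdeg⟩ := hmonic (n + 1)
    push_cast at hm hdeg
    have hlt : (C (ρ n) * P 0 n).degree < (P 0 ((n : ℤ) + 1)).degree := by
      rw [← smul_eq_C_mul]
      refine (degree_smul_le _ _).trans_lt ?_
      rw [degree_eq_natDegree hm.ne_zero, hdeg, degree_eq_natDegree (hmonic n).1.ne_zero,
        (hmonic n).2]
      exact_mod_cast n.lt_succ_self
    have hXm : (X * K n).Monic := by
      rw [hK n]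
      exact hm.sub_of_left hlt
    have hKm : (K n).Monic := monic_X.of_mul_monic_left hXm
    have hXdeg : (X * K n).natDegree = n + 1 := by
      rw [hK n, natDegree_eq_of_degree_eq (degree_sub_eq_left_of_degree_lt hlt), hdeg]
    rw [monic_X.natDegree_mul hKm, natDegree_X] at hXdeg
    exact ⟨hKm, by omega⟩
  · obtain ⟨c, hc⟩ := hquasi n
    refine ⟨fun i => c (i - 1), ?_⟩
    rw [hc, ← Finset.Ico_add_one_right_eq_Icc, Finset.sum_Ico_eq_sum_range]
    simp [sub_sub]
  · choose c hc using hquasi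
    obtain ⟨d, rfl⟩ : ∃ k, d = k + 1 := ⟨d - 1, by omega⟩
    set g : ℕ → ℕ → ℂ := fun n ν =>
      (if ν < d then c (n + 1) (ν + 1) else 0) - ρ n * c n ν with hg
    refine ⟨fun n => c (n + 1) 0 - ρ n,
      fun m μ => if m ≤ 0 then 0 else g (m.toNat + (d - μ)) (d - μ),
      fun m hm μ => if_pos hm, fun n => ?_⟩
    have hγ : ∀ ν ∈ Finset.range (d + 1),
        C (if (n : ℤ) - ν ≤ 0 then 0 else g (((n : ℤ) - ν).toNat +
          (d - (d + 1 - 1 - ν))) (d - (d + 1 - 1 - ν))) * K ((n : ℤ) - 1 - ν) =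
        C (g n ν) * K ((n : ℤ) - 1 - ν) := fun ν hν => by
      rw [Finset.mem_range] at hν
      split_ifs with h
      · rw [hKneg _ (by omega), mul_zero, mul_zero]
      · rw [show d - (d + 1 - 1 - ν) = ν by omega, show ((n : ℤ) - ν).toNat + ν = n by omega]
    rw [Finset.sum_congr rfl hγ]
    have hsum : ∑ ν ∈ Finset.range (d + 1), C (g n ν) * K ((n : ℤ) - 1 - ν) =
        ∑ ν ∈ Finset.range d, C (c (n + 1) (ν + 1)) * K ((n : ℤ) - 1 - ν) -
          C (ρ n) * ∑ ν ∈ Finset.range (d + 1), C (c n ν) * K ((n : ℤ) - 1 - ν) := by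
      simp only [hg, C_sub, C_mul, sub_mul, Finset.sum_sub_distrib, Finset.mul_sum, mul_assoc]
      congr 1
      rw [Finset.sum_range_succ, if_neg (lt_irrefl d), C_0, zero_mul, add_zero]
      exact Finset.sum_congr rfl fun ν hν => by rw [if_pos (Finset.mem_range.mp hν)]
    have hnext := hc (n + 1)
    rw [Finset.sum_range_succ'] at hnext
    have hshift : ∀ i : ℕ, (n : ℤ) - (i + 1) = n - 1 - i := fun i => by ring
    simp only [Nat.cast_add, Nat.cast_one, Nat.cast_zero, sub_zero, add_sub_cancel_right,
      hshift] at hnext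
    rw [hsum, C_sub]
    linear_combination -hK n - hnext + C (ρ n) * hc n
end

section
/- Assume that the normalized derivatives Q_n(x) := P_{n+1}′(x)/(n+1) satisfy a (d+2)-term recurrence of the same type: Q_n := 0 for n < 0, Q_0 = 1, and Q_{n+1}(x) = (x − ξ_n) Q_n(x) − Σ_{ν=0}^{d−1} g_{n−ν}^{d−1−ν} Q_{n−1−ν}(x) for n ≥ 0, for some complex numbers ξ_n (n ≥ 0) and g_n^ν (with g_n^ν := 0 for n ≤ 0) — i.e. (P_n) is a Hahn classical d-OPS. Then for every n ≥ 1: P_n(x) = Q_n(x) + n (β_n − ξ_{n−1}) Q_{n−1}(x) + Σ_{ν=0}^{d−1} ( (n−1−ν) γ_{n−ν}^{d−1−ν} − n · g_{n−1−ν}^{d−1−ν} ) Q_{n−2−ν}(x); in particular P_n is a linear combination of Q_n, Q_{n−1}, …, Q_{n−d−1}. -/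
open Polynomial

/-- `P_k' = k Q_{k-1}` for every integer index `k`. -/
theorem derivative_eq_intCast_mul {p Q : ℤ → Polynomial ℂ}
    (hpneg : ∀ n : ℤ, n < 0 → p n = 0) (hp0 : p 0 = 1)
    (hQneg : ∀ n : ℤ, n < 0 → Q n = 0)
    (hQdef : ∀ n : ℕ, ((n : ℂ) + 1) • Q (n : ℤ) = derivative (p ((n : ℤ) + 1)))
    (k : ℤ) : derivative (p k) = C (k : ℂ) * Q (k - 1) := by
  rcases lt_trichotomy k 0 with hk | rfl | hk
  · rw [hpneg k hk, hQneg (k - 1) (by lia)]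
    simp
  · simp [hp0]
  · obtain ⟨m, rfl⟩ : ∃ m : ℕ, k = (m : ℤ) + 1 := ⟨(k - 1).toNat, by lia⟩
    rw [← hQdef m, smul_eq_C_mul]
    simp

/-- For a Hahn classical d-OPS, `P_n` is an explicit linear combination of the normalized
derivatives `Q_n, Q_{n-1}, …, Q_{n-d-1}`. -/
theorem dOPS_hahn_classical_expansion
    (d : ℕ) (hd : 1 ≤ d)
    (β : ℕ → ℂ) (γ : ℤ → ℕ → ℂ)
    (hγzero : ∀ n : ℤ, n ≤ 0 → ∀ ν : ℕ, γ n ν = 0)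
    (hγne : ∀ n : ℤ, 1 ≤ n → γ n 0 ≠ 0)
    (P : ℕ → ℤ → Polynomial ℂ)
    (hPneg : ∀ (r : ℕ) (n : ℤ), n < 0 → P r n = 0)
    (hP0 : ∀ r : ℕ, P r 0 = 1)
    (hPrec : ∀ r n : ℕ,
      P r ((n : ℤ) + 1) =
        (X - C (β (n + r))) * P r (n : ℤ) -
          ∑ ν ∈ Finset.range d, C (γ ((n : ℤ) + r - ν) (d - 1 - ν)) * P r ((n : ℤ) - 1 - ν))
    (Q : ℤ → Polynomial ℂ)
    (hQneg : ∀ n : ℤ, n < 0 → Q n = 0)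
    (hQdef : ∀ n : ℕ, ((n : ℂ) + 1) • Q (n : ℤ) = Polynomial.derivative (P 0 ((n : ℤ) + 1)))
    (ξ : ℕ → ℂ) (g : ℤ → ℕ → ℂ)
    (hgzero : ∀ n : ℤ, n ≤ 0 → ∀ ν : ℕ, g n ν = 0)
    (hQrec : ∀ n : ℕ,
      Q ((n : ℤ) + 1) =
        (X - C (ξ n)) * Q (n : ℤ) -
          ∑ ν ∈ Finset.range d, C (g ((n : ℤ) - ν) (d - 1 - ν)) * Q ((n : ℤ) - 1 - ν)) :
    ∀ n : ℕ, 1 ≤ n →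
      P 0 (n : ℤ) =
        Q (n : ℤ) + C ((n : ℂ) * (β n - ξ (n - 1))) * Q ((n : ℤ) - 1) +
          ∑ ν ∈ Finset.range d,
            C (((n : ℂ) - 1 - ν) * γ ((n : ℤ) - ν) (d - 1 - ν)
                - (n : ℂ) * g ((n : ℤ) - 1 - ν) (d - 1 - ν)) * Q ((n : ℤ) - 2 - ν) := by
  intro n hn
  obtain ⟨m, rfl⟩ : ∃ m : ℕ, n = m + 1 := ⟨n - 1, by lia⟩
  have hderiv := derivative_eq_intCast_mul (hPneg 0) (hP0 0) hQneg hQdef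
  have hP := congrArg derivative (hPrec 0 (m + 1))
  simp only [derivative_sub, derivative_mul, derivative_sum, derivative_X, derivative_C,
    hderiv, zero_mul, zero_add] at hP
  have hQ := hQrec m
  have hsum : ∑ ν ∈ Finset.range d,
      C ((((m + 1 : ℕ) : ℂ) - 1 - ν) * γ (((m + 1 : ℕ) : ℤ) - ν) (d - 1 - ν)
        - ((m + 1 : ℕ) : ℂ) * g (((m + 1 : ℕ) : ℤ) - 1 - ν) (d - 1 - ν))
          * Q (((m + 1 : ℕ) : ℤ) - 2 - ν) =
      ∑ ν ∈ Finset.range d, C (γ (((m + 1 : ℕ) : ℤ) + (0 : ℕ) - ν) (d - 1 - ν))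
          * (C (((((m + 1 : ℕ) : ℤ) - 1 - ν : ℤ) : ℂ)) * Q (((m + 1 : ℕ) : ℤ) - 1 - ν - 1))
      - C ((m : ℂ) + 1) * ∑ ν ∈ Finset.range d, C (g ((m : ℤ) - ν) (d - 1 - ν))
          * Q ((m : ℤ) - 1 - ν) := by
    rw [Finset.mul_sum, ← Finset.sum_sub_distrib]
    refine Finset.sum_congr rfl fun ν _ => ?_
    have e₁ : ((m + 1 : ℕ) : ℤ) - 2 - ν = (m : ℤ) - 1 - ν := by lia
    have e₂ : ((m + 1 : ℕ) : ℤ) - 1 - ν - 1 = (m : ℤ) - 1 - ν := by lia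
    have e₃ : ((m + 1 : ℕ) : ℤ) - 1 - ν = (m : ℤ) - ν := by lia
    have e₄ : ((m + 1 : ℕ) : ℤ) + (0 : ℕ) - ν = ((m + 1 : ℕ) : ℤ) - ν := by lia
    rw [e₁, e₂, e₃, e₄]
    push_cast
    simp only [map_sub, map_mul, map_add, map_one]
    ring
  rw [hsum]
  simp only [Nat.cast_add, Nat.cast_one, add_sub_cancel_right,
    Nat.add_sub_cancel, Int.cast_add, Int.cast_one, Int.cast_natCast, map_add, map_mul, map_sub,
    map_one, add_zero] at hP hQ ⊢
  linear_combination -hP + ((C (m : ℂ)) + 1) * hQ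
end

section
/- The following hold: (i) B_{(d+1)n+s}(x) = x^s · B_n^s(x^{d+1}) for all n ≥ 0 and 0 ≤ s ≤ d (i.e. (B_n) is d-symmetric and the B_n^s are its components); (ii) each B_n^s is monic of degree n; (iii) x · B_n^d(x) = B_{n+1}^0(x) + ρ_{(d+1)n+1} · B_n^0(x) for all n ≥ 0; (iv) B_{n+1}^i(x) = B_{n+1}^{i+1}(x) + ρ_{(d+1)n+i+2} · B_n^{i+1}(x) for all n ≥ 0 and 0 ≤ i ≤ d−1. -/
open Polynomial

/-- A polynomial sequence with a `d`-symmetric recurrence is supported, in index `m`, on the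
exponents `m - (d + 1) * j`, and is normalized at the exponent `m`. -/
theorem dSym_support_and_leading_coeff {R : Type*} [CommRing R] (d : ℕ) (ρ : ℕ → R)
    (B : ℕ → R[X]) (hBlow : ∀ n, n ≤ d → B n = X ^ n)
    (hBrec : ∀ n, B (n + d + 1) = X * B (n + d) - C (ρ n) * B n) (m : ℕ) :
    (∀ k, (B m).coeff k ≠ 0 → ∃ j, k + (d + 1) * j = m) ∧ (B m).coeff m = 1 := by
  induction m using Nat.strong_induction_on with
  | _ m ih =>
    rcases le_or_gt m d with hm | hm
    · rw [hBlow m hm]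
      refine ⟨fun k hk => ⟨0, ?_⟩, by simp⟩
      by_contra hne
      exact hk (by rw [coeff_X_pow, if_neg (by simpa using hne)])
    · obtain ⟨n, rfl⟩ : ∃ n, m = n + d + 1 := ⟨m - d - 1, by omega⟩
      obtain ⟨hsupp, hlead⟩ := ih (n + d) (by omega)
      obtain ⟨hsupp', -⟩ := ih n (by omega)
      rw [hBrec]
      constructor
      · intro k hk
        by_cases h : (B n).coeff k = 0
        · cases k with
          | zero => simp [h] at hk
          | succ k =>
            obtain ⟨j, hj⟩ := hsupp k (by simpa [coeff_X_mul, h] using hk)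
            exact ⟨j, by omega⟩
        · obtain ⟨j, hj⟩ := hsupp' k h
          exact ⟨j + 1, by rw [mul_add]; omega⟩
      · have h : (B n).coeff (n + d + 1) = 0 := by
          by_contra h
          obtain ⟨j, hj⟩ := hsupp' _ h
          omega
        simp [coeff_X_mul, h, hlead]

/-- Components of a d-symmetric d-OPS: (d+1)-decomposition, monicity, and the connection
relations between consecutive components. -/
theorem dSym_components
    (d : ℕ) (hd : 1 ≤ d)
    (ρ : ℤ → ℂ)
    (hρne : ∀ n : ℤ, 1 ≤ n → ρ n ≠ 0)
    (hρzero : ∀ n : ℤ, n ≤ 0 → ρ n = 0)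
    (B : ℕ → Polynomial ℂ)
    (hBlow : ∀ n : ℕ, n ≤ d → B n = X ^ n)
    (hBrec : ∀ n : ℕ, B (n + d + 1) = X * B (n + d) - C (ρ ((n : ℤ) + 1)) * B n)
    (Bc : ℕ → ℤ → Polynomial ℂ)
    (hBcneg : ∀ (s : ℕ) (n : ℤ), n < 0 → Bc s n = 0)
    (hBc : ∀ s : ℕ, s ≤ d → ∀ n p : ℕ,
      (Bc s (n : ℤ)).coeff p = (B ((d + 1) * n + s)).coeff ((d + 1) * p + s)) :
    (∀ n : ℕ, ∀ s : ℕ, s ≤ d →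
        B ((d + 1) * n + s) = X ^ s * (Bc s (n : ℤ)).comp (X ^ (d + 1)))
    ∧ (∀ n : ℕ, ∀ s : ℕ, s ≤ d → (Bc s (n : ℤ)).Monic ∧ (Bc s (n : ℤ)).natDegree = n)
    ∧ (∀ n : ℕ,
        X * Bc d (n : ℤ) = Bc 0 ((n : ℤ) + 1) + C (ρ ((d + 1) * (n : ℤ) + 1)) * Bc 0 (n : ℤ))
    ∧ (∀ n : ℕ, ∀ i : ℕ, i ≤ d - 1 →
        Bc i ((n : ℤ) + 1) =
          Bc (i + 1) ((n : ℤ) + 1) + C (ρ ((d + 1) * (n : ℤ) + i + 2)) * Bc (i + 1) (n : ℤ)) := by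
  have hB := dSym_support_and_leading_coeff d (fun n => ρ ((n : ℤ) + 1)) B hBlow hBrec
  refine ⟨fun n s hs => ?_, fun n s hs => ?_, fun n => ?_, fun n i hi => ?_⟩
  · ext k
    rw [← expand_eq_comp_X_pow, coeff_X_pow_mul', coeff_expand (Nat.succ_pos d)]
    by_cases hk : ∃ p, k = (d + 1) * p + s
    · obtain ⟨p, rfl⟩ := hk
      simp [hBc s hs]
    · have hzero : (B ((d + 1) * n + s)).coeff k = 0 := by
        by_contra h
        obtain ⟨j, hj⟩ := (hB _).1 k h
        have hjn : j ≤ n := by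
          by_contra! hlt
          have := Nat.mul_le_mul_left (d + 1) (Nat.succ_le_of_lt hlt)
          rw [Nat.mul_succ] at this
          omega
        refine hk ⟨n - j, ?_⟩
        have := Nat.mul_le_mul_left (d + 1) hjn
        rw [Nat.mul_sub]
        omega
      rw [hzero]
      split_ifs with h₁ h₂
      · obtain ⟨p, hp⟩ := h₂
        rw [Nat.succ_eq_add_one] at hp
        exact absurd ⟨p, by omega⟩ hk
      · rfl
      · rfl
  · have hlead : (Bc s (n : ℤ)).coeff n = 1 := by rw [hBc s hs, (hB _).2]
    have hle : (Bc s (n : ℤ)).natDegree ≤ n := by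
      refine natDegree_le_iff_coeff_eq_zero.2 fun p hp => ?_
      rw [hBc s hs]
      by_contra h
      obtain ⟨j, hj⟩ := (hB _).1 _ h
      have := Nat.mul_lt_mul_of_pos_left hp (Nat.succ_pos d)
      simp only [Nat.succ_eq_add_one] at this
      omega
    exact ⟨monic_of_natDegree_le_of_coeff_eq_one n hle hlead,
      natDegree_eq_of_le_of_coeff_ne_zero hle (by simp [hlead])⟩
  · ext p
    have hrec := hBrec ((d + 1) * n)
    push_cast at hrec
    have hsucc := hBc 0 (Nat.zero_le d) (n + 1) p
    push_cast at hsucc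
    rw [coeff_add, coeff_C_mul, hsucc, hBc 0 (Nat.zero_le d),
      show (d + 1) * (n + 1) + 0 = (d + 1) * n + d + 1 by ring, hrec, coeff_sub, coeff_C_mul,
      add_zero, add_zero, sub_add_cancel]
    cases p with
    | zero => simp
    | succ p =>
      rw [coeff_X_mul, hBc d le_rfl, show (d + 1) * (p + 1) = (d + 1) * p + d + 1 by ring,
        coeff_X_mul]
  · have hid : i + 1 ≤ d := by omega
    ext p
    have hrec := hBrec ((d + 1) * n + i + 1)
    push_cast at hrec
    have hsucc := hBc (i + 1) hid (n + 1) p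
    have hsucc' := hBc i (by omega) (n + 1) p
    push_cast at hsucc hsucc'
    rw [coeff_add, coeff_C_mul, hsucc, hsucc', hBc (i + 1) hid,
      show (d + 1) * (n + 1) + (i + 1) = (d + 1) * n + i + 1 + d + 1 by ring, hrec, coeff_sub,
      coeff_C_mul, ← add_assoc ((d + 1) * p), coeff_X_mul,
      show (d + 1) * (n + 1) + i = (d + 1) * n + i + 1 + d by ring,
      show ((d : ℤ) + 1) * n + i + 1 + 1 = (d + 1) * n + i + 2 by ring,
      ← add_assoc ((d + 1) * n), sub_add_cancel]
end

section
/- For every n ≥ 0 and every 0 ≤ s ≤ d, the s-th component satisfies the (d+2)-term recurrence x · B_n^s(x) = B_{n+1}^s(x) + Σ_{k=1}^{d+1} Σ_{1 ≤ i_1 ≤ i_2 ≤ … ≤ i_k ≤ d−k+2} ( Π_{t=1}^{k} ρ_{(n−t)(d+1)+i_t+t+s} ) · B_{n+1−k}^s(x). -/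
open Polynomial

open scoped Classical in
/-- The weight sum over nondecreasing `k`-tuples `i` with `a ≤ i t` and `i t + k ≤ c`. These tuples
encode the lattice paths with `k` down-steps of size `d`, in which `i t - a` up-steps of size `1`
precede the `t`-th down-step. -/
noncomputable def tupleWeight {R : Type*} [CommRing R] (d M : ℕ) (ρ : ℤ → R)
    (k a c : ℕ) (m : ℤ) : R :=
  ∑ i : Fin k → Fin M,
    if (Monotone fun t => ((i t : ℕ))) ∧ (∀ t : Fin k, a ≤ (i t : ℕ) ∧ (i t : ℕ) + k ≤ c) then
      ∏ t : Fin k, ρ (m + (i t : ℕ) - d * ((t : ℕ) + 1) + 1)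
    else 0

lemma tupleWeight_zero {R : Type*} [CommRing R] (d M : ℕ) (ρ : ℤ → R) (a c : ℕ) (m : ℤ) :
    tupleWeight d M ρ 0 a c m = 1 := by
  have h (i : Fin 0 → Fin M) : Monotone fun t => ((i t : ℕ)) := fun t => t.elim0
  simp [tupleWeight, h]

lemma tupleWeight_eq_zero {R : Type*} [CommRing R] (d M : ℕ) (ρ : ℤ → R) {k a c : ℕ} (m : ℤ)
    (hk : 0 < k) (h : c < a + k) : tupleWeight d M ρ k a c m = 0 := by
  refine Finset.sum_eq_zero fun i _ => if_neg fun hi => ?_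
  have := hi.2 ⟨0, hk⟩
  omega

lemma monotone_fin_cons_iff {M k : ℕ} (x : Fin M) (y : Fin k → Fin M) :
    (Monotone fun t => (((Fin.cons x y : Fin (k + 1) → Fin M) t : ℕ))) ↔
      (∀ t, (x : ℕ) ≤ y t) ∧ Monotone fun t => ((y t : ℕ)) := by
  constructor
  · intro h
    refine ⟨fun t => by simpa using h (Fin.zero_le t.succ), fun s t hst => ?_⟩
    simpa using h (Fin.succ_le_succ_iff.2 hst)
  · rintro ⟨h0, h⟩ s t hst
    cases s using Fin.cases with
    | zero =>
      cases t using Fin.cases with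
      | zero => simp
      | succ t => simpa using h0 t
    | succ s =>
      cases t using Fin.cases with
      | zero => exact absurd hst (by simp)
      | succ t => simpa using h (Fin.succ_le_succ_iff.1 hst)

/-- Splitting the tuples according to whether the first entry equals the lower bound `a`. -/
lemma tupleWeight_succ {R : Type*} [CommRing R] (d M : ℕ) (ρ : ℤ → R) (k : ℕ) {a c : ℕ} (m : ℤ)
    (haM : a < M) (hac : a ≤ c) :
    tupleWeight d M ρ (k + 1) a (c + 1) m =
      tupleWeight d M ρ (k + 1) (a + 1) (c + 1) m +
        ρ (m + a - d + 1) * tupleWeight d M ρ k a c (m - d) := by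
  classical
  have key : ρ (m + a - d + 1) * tupleWeight d M ρ k a c (m - d) =
      ∑ x : Fin M, ∑ y : Fin k → Fin M,
        if x = ⟨a, haM⟩ then
          if (Monotone fun t => ((y t : ℕ))) ∧ (∀ t, a ≤ (y t : ℕ) ∧ (y t : ℕ) + k ≤ c) then
            ρ (m + a - d + 1) * ∏ t : Fin k, ρ (m - d + (y t : ℕ) - d * ((t : ℕ) + 1) + 1)
          else 0
        else 0 := by
    rw [Finset.sum_comm]
    simp [tupleWeight, Finset.mul_sum]
  have hsplit (f : (Fin (k + 1) → Fin M) → R) :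
      ∑ i, f i = ∑ x : Fin M, ∑ y : Fin k → Fin M, f (Fin.cons x y) := by
    rw [← (Fin.consEquiv fun _ => Fin M).sum_comp, Fintype.sum_prod_type]
    rfl
  rw [key]
  unfold tupleWeight
  rw [hsplit, hsplit, ← Finset.sum_add_distrib]
  refine Finset.sum_congr rfl fun x _ => ?_
  rw [← Finset.sum_add_distrib]
  refine Finset.sum_congr rfl fun y _ => ?_
  simp only [monotone_fin_cons_iff, Fin.forall_fin_succ, Fin.cons_zero, Fin.cons_succ,
    Fin.prod_univ_succ, Fin.val_zero, Fin.val_succ]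
  by_cases hx : x = ⟨a, haM⟩
  · subst hx
    have hfalse : ¬ (a + 1 ≤ a) := by omega
    simp only [hfalse, false_and, and_false, if_false, if_true, zero_add]
    refine if_congr ?_ ?_ rfl
    · constructor
      · rintro ⟨⟨_, hy⟩, _, hb⟩
        exact ⟨hy, fun t => ⟨(hb t).1, by have := (hb t).2; omega⟩⟩
      · rintro ⟨hy, hb⟩
        refine ⟨⟨fun t => (hb t).1, hy⟩, ⟨le_rfl, ?_⟩, fun t => ⟨(hb t).1, ?_⟩⟩
        · rcases Nat.eq_zero_or_pos k with rfl | hk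
          · omega
          · have := hb ⟨0, hk⟩
            omega
        · have := (hb t).2
          omega
    · congr 1
      · congr 1
        push_cast
        ring
      · refine Finset.prod_congr rfl fun t _ => ?_
        congr 1
        push_cast
        ring
  · have hxa : (x : ℕ) ≠ a := fun h => hx (Fin.ext h)
    rw [if_neg hx, add_zero]
    refine if_congr ?_ rfl rfl
    constructor
    · rintro ⟨⟨h0, hy⟩, hb0, hb⟩
      refine ⟨⟨h0, hy⟩, ⟨by omega, hb0.2⟩, fun t => ⟨?_, (hb t).2⟩⟩
      have := h0 t
      omega
    · rintro ⟨⟨h0, hy⟩, hb0, hb⟩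
      exact ⟨⟨h0, hy⟩, ⟨by omega, hb0.2⟩, fun t => ⟨by have := (hb t).1; omega, (hb t).2⟩⟩

/-- Iterating `X * E m = E (m + 1) + ρ (m - d + 1) * E (m - d)` expands `X ^ N * E m` as a sum over
lattice paths. -/
lemma X_pow_mul_eq_sum_tupleWeight {R : Type*} [CommRing R] (d M : ℕ) (ρ : ℤ → R)
    (hρ : ∀ n : ℤ, n ≤ 0 → ρ n = 0) (E : ℤ → R[X])
    (hE : ∀ m : ℤ, 0 ≤ m → X * E m = E (m + 1) + C (ρ (m - d + 1)) * E (m - d))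
    (N a : ℕ) (m : ℤ) (hm : 0 ≤ m) (hM : a + N ≤ M) :
    X ^ N * E m = ∑ k ∈ Finset.range (N + 1),
      C (tupleWeight d M ρ k a (a + N) (m - a)) * E (m + N - k - d * k) := by
  induction N generalizing a m with
  | zero => simp [tupleWeight_zero]
  | succ N ih =>
    have hup := ih (a + 1) (m + 1) (by omega) (by omega)
    have hdown : C (ρ (m - d + 1)) * (X ^ N * E (m - d)) = ∑ k ∈ Finset.range (N + 1),
        C (ρ (m - d + 1) * tupleWeight d M ρ k a (a + N) (m - a - d)) *
          E (m + (N + 1 : ℕ) - (k + 1 : ℕ) - d * (k + 1 : ℕ)) := by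
      by_cases h : 0 ≤ m - d
      · rw [ih a (m - d) h (by omega), Finset.mul_sum]
        refine Finset.sum_congr rfl fun k _ => ?_
        rw [C_mul, mul_assoc, show m - (d : ℤ) - a = m - a - d by ring]
        congr 3
        push_cast
        ring
      · simp [hρ (m - d + 1) (by omega)]
    have hstep (k : ℕ) : tupleWeight d M ρ (k + 1) a (a + (N + 1)) (m - a) =
        tupleWeight d M ρ (k + 1) (a + 1) (a + (N + 1)) (m - a) +
          ρ (m - d + 1) * tupleWeight d M ρ k a (a + N) (m - a - d) := by
      rw [← add_assoc, tupleWeight_succ d M ρ k (m - a) (by omega) (by omega)]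
      congr 3
      ring
    rw [Finset.sum_range_succ', tupleWeight_zero]
    simp only [hstep, C_add, add_mul, Finset.sum_add_distrib]
    rw [← hdown, pow_succ, mul_assoc, hE m hm, mul_add, hup, Finset.sum_range_succ',
      tupleWeight_zero, Finset.sum_range_succ _ N,
      tupleWeight_eq_zero d M ρ (m - a) N.succ_pos (by omega : a + (N + 1) < a + 1 + (N + 1))]
    have hsum : ∑ k ∈ Finset.range N, C (tupleWeight d M ρ (k + 1) (a + 1) (a + 1 + N)
          (m + 1 - (a + 1 : ℕ))) * E (m + 1 + N - (k + 1 : ℕ) - d * (k + 1 : ℕ)) =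
        ∑ k ∈ Finset.range N, C (tupleWeight d M ρ (k + 1) (a + 1) (a + (N + 1)) (m - a)) *
          E (m + (N + 1 : ℕ) - (k + 1 : ℕ) - d * (k + 1 : ℕ)) := by
      refine Finset.sum_congr rfl fun k _ => ?_
      rw [show a + 1 + N = a + (N + 1) by omega,
        show m + 1 - ((a + 1 : ℕ) : ℤ) = m - a by push_cast; ring,
        show m + 1 + (N : ℤ) = m + (N + 1 : ℕ) by push_cast; ring]
    have hzero : E (m + 1 + N - (0 : ℕ) - d * (0 : ℕ)) =
        E (m + (N + 1 : ℕ) - (0 : ℕ) - d * (0 : ℕ)) := by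
      congr 1
      push_cast
      ring
    rw [hsum, hzero]
    simp only [map_zero, zero_mul]
    ring

open scoped Classical in
/-- The (d+2)-term recurrence relation satisfied by each component of a d-symmetric d-OPS,
with coefficients given by sums over nondecreasing index tuples. -/
theorem dSym_component_recurrence
    (d : ℕ) (hd : 1 ≤ d)
    (ρ : ℤ → ℂ)
    (hρne : ∀ n : ℤ, 1 ≤ n → ρ n ≠ 0)
    (hρzero : ∀ n : ℤ, n ≤ 0 → ρ n = 0)
    (B : ℕ → Polynomial ℂ)
    (hBlow : ∀ n : ℕ, n ≤ d → B n = X ^ n)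
    (hBrec : ∀ n : ℕ, B (n + d + 1) = X * B (n + d) - C (ρ ((n : ℤ) + 1)) * B n)
    (Bc : ℕ → ℤ → Polynomial ℂ)
    (hBcneg : ∀ (s : ℕ) (n : ℤ), n < 0 → Bc s n = 0)
    (hBc : ∀ s : ℕ, s ≤ d → ∀ n p : ℕ,
      (Bc s (n : ℤ)).coeff p = (B ((d + 1) * n + s)).coeff ((d + 1) * p + s)) :
    ∀ n s : ℕ, s ≤ d →
      X * Bc s (n : ℤ) =
        Bc s ((n : ℤ) + 1) +
          ∑ k ∈ Finset.Icc 1 (d + 1),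
            ∑ i : Fin k → Fin (d + 2),
              if (Monotone fun t => ((i t : ℕ))) ∧
                  (∀ t : Fin k, 1 ≤ (i t : ℕ) ∧ (i t : ℕ) ≤ d + 2 - k) then
                C (∏ t : Fin k,
                    ρ (((n : ℤ) - ((t : ℕ) + 1)) * ((d : ℤ) + 1) + (i t : ℕ) + ((t : ℕ) + 1) + s))
                  * Bc s ((n : ℤ) + 1 - k)
              else 0 := by
  classical
  intro n s hs
  let E : ℤ → ℂ[X] := fun m => if m < 0 then 0 else B m.toNat
  have hEnat (m : ℕ) : E m = B m := by simp [E]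
  have hE (m : ℤ) (hm : 0 ≤ m) : X * E m = E (m + 1) + C (ρ (m - d + 1)) * E (m - d) := by
    lift m to ℕ using hm
    rw [← Nat.cast_succ, hEnat, hEnat]
    by_cases h : d ≤ m
    · obtain ⟨j, rfl⟩ := Nat.exists_eq_add_of_le' h
      rw [show ((j + d : ℕ) : ℤ) - d = j by push_cast; ring, hEnat, Nat.succ_eq_add_one, hBrec]
      ring
    · rw [hρzero _ (by omega), hBlow _ (by omega), hBlow _ (by omega)]
      simp [pow_succ']
  have hcoeff (j : ℤ) (p : ℕ) :
      (E ((d + 1) * j + s)).coeff ((d + 1) * p + s) = (Bc s j).coeff p := by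
    by_cases hj : 0 ≤ j
    · lift j to ℕ using hj
      rw [hBc s hs, ← hEnat]
      push_cast
      rfl
    · have hneg : ((d : ℤ) + 1) * j + s < 0 := by nlinarith
      simp [E, hneg, hBcneg s j (by omega)]
  have hexp := X_pow_mul_eq_sum_tupleWeight d (d + 2) ρ hρzero E hE (d + 1) 1
    ((d + 1) * n + s) (by positivity) (by omega)
  have hcomp : X * Bc s (n : ℤ) = ∑ k ∈ Finset.range (d + 1 + 1),
      C (tupleWeight d (d + 2) ρ k 1 (1 + (d + 1)) ((d + 1) * n + s - (1 : ℕ))) *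
        Bc s ((n : ℤ) + 1 - k) := by
    ext p
    have h := congrArg (fun q => q.coeff ((d + 1) * p + s)) hexp
    simp only [finsetSum_coeff, coeff_C_mul] at h ⊢
    have hidx (k : ℕ) : ((d : ℤ) + 1) * n + s + (d + 1 : ℕ) - k - d * k =
        (d + 1) * ((n : ℤ) + 1 - k) + s := by
      push_cast
      ring
    simp only [hidx, hcoeff] at h
    rw [← h]
    cases p with
    | zero => rw [coeff_X_mul_zero, coeff_X_pow_mul', if_neg (by omega)]
    | succ p =>
      rw [coeff_X_mul, show (d + 1) * (p + 1) + s = (d + 1) * p + s + (d + 1) by ring,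
        coeff_X_pow_mul, hcoeff]
  rw [hcomp, Finset.sum_range_succ', tupleWeight_zero, add_comm]
  congr 1
  · simp
  rw [Finset.range_eq_Ico, Finset.sum_Ico_add' (fun k : ℕ =>
    C (tupleWeight d (d + 2) ρ k 1 (1 + (d + 1)) ((d + 1) * n + s - (1 : ℕ))) *
        Bc s ((n : ℤ) + 1 - k)) 0 (d + 1) 1]
  refine Finset.sum_congr (by ext; simp) fun k hk => ?_
  rw [Finset.mem_Icc] at hk
  rw [tupleWeight, map_sum, Finset.sum_mul]
  refine Finset.sum_congr rfl fun i _ => ?_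
  rw [apply_ite C, C_0, ite_mul, zero_mul]
  refine if_congr (and_congr_right fun _ => forall_congr' fun t => by omega) ?_ rfl
  congr 2
  refine Finset.prod_congr rfl fun t _ => ?_
  congr 1
  push_cast
  ring
end
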